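/- Let K be a field, E a finite set with |E| > 3, and W ⊆ K^E a realization of a 3-connected matroid M. Then every minimal prime p of K[x_e : e ∈ E] over the Jacobian ideal J_W (equivalently, over the submaximal-minor ideal M_W) contains no coordinate: x_e ∉ p for all e ∈ E. In other words, all generic points of Σ_W and Δ_W lie in the torus (K^*)^E. -/

import Mathlib

open scoped BigOperators

namespace Config

variable {K : Type} [Field K] {E : Type} [Fintype E] [DecidableEq E]

/-- `w` is a (linear) basis of the configuration `W ⊆ K^E`. -/
def IsBasisOf {r : ℕ} (w : Fin r → E → K) (W : Submodule K (E → K)) : Prop :=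
  LinearIndependent K w ∧ Submodule.span K (Set.range w) = W

/-- The configuration (bilinear) form `Q_W` computed from the basis `w`: the symmetric
`r × r` matrix with entries `∑_{e ∈ E} x_e · w^i_e · w^j_e` over `K[x_e : e ∈ E]`. -/
noncomputable def Qform {r : ℕ} (w : Fin r → E → K) :
    Matrix (Fin r) (Fin r) (MvPolynomial E K) :=
  Matrix.of fun i j => ∑ e : E, MvPolynomial.C (w i e * w j e) * MvPolynomial.X e

/-- The configuration polynomial `ψ_W = det Q_W` computed from the basis `w`. -/
noncomputable def psi {r : ℕ} (w : Fin r → E → K) : MvPolynomial E K :=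
  (Qform w).det

/-- The ideal `M_W` generated by the submaximal, i.e. `(r−1) × (r−1)`, minors of the
configuration form `Q_W`. -/
noncomputable def minorIdeal {r : ℕ} (w : Fin r → E → K) : Ideal (MvPolynomial E K) :=
  Ideal.span {p | ∃ f g : Fin (r - 1) ↪ Fin r, p = Matrix.det ((Qform w).submatrix f g)}

/-- The Jacobian ideal `J_W = ⟨ψ_W⟩ + ⟨∂ψ_W/∂x_e : e ∈ E⟩`. -/
noncomputable def jacIdeal {r : ℕ} (w : Fin r → E → K) : Ideal (MvPolynomial E K) :=
  Ideal.span ({psi w} ∪ Set.range fun e => MvPolynomial.pderiv e (psi w))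

/-- The rank in `M_W` of a subset `S ⊆ E`: the dimension of the image of `W`
under the projection onto the coordinates in `S`. -/
noncomputable def rkOn (W : Submodule K (E → K)) (S : Finset E) : ℕ :=
  Module.finrank K (W.map (LinearMap.funLeft K K (fun e : {x : E // x ∈ S} => (e : E))))

/-- `S` is a `k`-separation of the matroid `M_W`:
`λ(S) = rk S + rk Sᶜ − rk M < k ≤ min (|S|, |Sᶜ|)`. -/
def KSep (W : Submodule K (E → K)) (k : ℕ) (S : Finset E) : Prop :=
  rkOn W S + rkOn W Sᶜ < rkOn W Finset.univ + k ∧ k ≤ S.card ∧ k ≤ Sᶜ.card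

/-- The matroid `M_W` is 3-connected: it has no 1-separation and no 2-separation. -/
def ThreeConnected (W : Submodule K (E → K)) : Prop :=
  ∀ S : Finset E, ¬ KSep W 1 S ∧ ¬ KSep W 2 S

set_option linter.unusedSectionVars false
set_option linter.unusedSimpArgs false
set_option linter.unusedVariables false

open scoped Matrix

section LinAlg

variable {F : Type*} [Field F]

lemma exists_cols {m n : Type*} [Fintype m] [Fintype n] (A : Matrix m n F) {k : ℕ}
    (hk : k ≤ A.rank) : ∃ g : Fin k ↪ n, (A.submatrix id g).rank = k := by
  obtain ⟨κ, a, ha, hs, hl⟩ := exists_linearIndependent' F A.col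
  have : Finite κ := Finite.of_injective a ha
  have := Fintype.ofFinite κ
  have hc : Fintype.card κ = A.rank := by
    rw [Matrix.rank_eq_finrank_span_cols, ← hs]
    exact (finrank_span_eq_card hl).symm
  obtain ⟨h⟩ : Nonempty (Fin k ↪ κ) := by
    apply Function.Embedding.nonempty_of_card_le
    simp [hc, hk]
  refine ⟨h.trans ⟨a, ha⟩, ?_⟩
  rw [Matrix.rank_eq_finrank_span_cols]
  have h2 : LinearIndependent F (A.submatrix id (h.trans ⟨a, ha⟩)).col := hl.comp h h.injective
  simpa using finrank_span_eq_card h2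

lemma le_rank_iff {m n : Type*} [Fintype m] [Fintype n] (A : Matrix m n F) {k : ℕ} :
    k ≤ A.rank ↔ ∃ (f : Fin k ↪ m) (g : Fin k ↪ n), (A.submatrix f g).det ≠ 0 := by
  constructor
  · intro hk
    obtain ⟨g, hg⟩ := exists_cols A hk
    obtain ⟨f, hf⟩ := exists_cols (A.submatrix id g)ᵀ (k := k) (by rw [Matrix.rank_transpose, hg])
    refine ⟨f, g, fun h0 => ?_⟩
    have h1 : ((A.submatrix f g)).rank = k := by
      rw [← Matrix.rank_transpose]; exact hf
    have h2 := (A.submatrix f g).exists_mulVec_eq_zero_iff.mpr h0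
    obtain ⟨v, hv, hv0⟩ := h2
    have h3 := (A.submatrix f g).mulVecLin.finrank_range_add_finrank_ker
    have h4 : Module.finrank F (LinearMap.range (A.submatrix f g).mulVecLin) = k := h1
    have h5 : 0 < Module.finrank F (LinearMap.ker (A.submatrix f g).mulVecLin) := by
      rw [Module.finrank_pos_iff_exists_ne_zero]
      exact ⟨⟨v, by simpa using hv0⟩, fun h => hv (congrArg Subtype.val h)⟩
    simp at h3
    omega
  · rintro ⟨f, g, h⟩
    have := Matrix.rank_of_det_ne_zero h
    have h2 := Matrix.rank_submatrix_le A f g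
    simp at this
    omega

lemma rank_eq_of_ker {R F F' : Type*} [CommRing R] [Field F] [Field F'] {m n : Type*} [Fintype m]
    [Fintype n] (φ : R →+* F) (φ' : R →+* F') (h : RingHom.ker φ = RingHom.ker φ')
    (A : Matrix m n R) : (A.map φ).rank = (A.map φ').rank := by
  have : ∀ k, k ≤ (A.map φ).rank ↔ k ≤ (A.map φ').rank := by
    intro k
    rw [le_rank_iff, le_rank_iff]
    refine exists_congr fun f => exists_congr fun g => ?_
    rw [Matrix.submatrix_map, Matrix.submatrix_map, ← RingHom.mapMatrix_apply, ← RingHom.map_det,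
      ← RingHom.mapMatrix_apply, ← RingHom.map_det, Ne, Ne, ← RingHom.mem_ker, h, RingHom.mem_ker]
  exact le_antisymm ((this _).1 le_rfl) ((this _).2 le_rfl)

/-- All submaximal minors vanish iff the corank is at least two. -/
lemma minors_zero_iff {r : ℕ} (M : Matrix (Fin r) (Fin r) F) :
    (∀ f g : Fin (r - 1) ↪ Fin r, (M.submatrix f g).det = 0) ↔ M.rank + 2 ≤ r := by
  have h := le_rank_iff M (k := r - 1)
  constructor
  · intro h1
    have h2 : ¬ (r - 1 ≤ M.rank) := by
      rw [h]; push Not; exact h1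
    omega
  · intro h1
    have h2 : ¬ (r - 1 ≤ M.rank) := by omega
    rw [h] at h2; push Not at h2; exact h2

lemma exists_ker_of_notMem {r : ℕ} (Q : Matrix (Fin r) (Fin r) F) (hQ : Q.IsSymm)
    (V : Submodule F (Fin r → F)) (hV : LinearMap.range Q.mulVecLin ≤ V)
    (a : Fin r → F) (ha : a ∉ V) :
    ∃ v, Q.mulVec v = 0 ∧ (∀ u ∈ V, u ⬝ᵥ v = 0) ∧ a ⬝ᵥ v ≠ 0 := by
  obtain ⟨f, hf, hle⟩ := Submodule.exists_le_ker_of_notMem ha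
  obtain ⟨v, rfl⟩ := (dotProductEquiv F (Fin r)).surjective f
  have hle' : ∀ u ∈ V, u ⬝ᵥ v = 0 := by
    intro u hu
    have := hle hu
    simpa [dotProduct_comm] using this
  refine ⟨v, ?_, hle', ?_⟩
  · apply dotProduct_eq_zero
    intro u
    have h1 := hle' (Q.mulVec u) (hV ⟨u, rfl⟩)
    rw [dotProduct_comm, Matrix.dotProduct_mulVec, ← Matrix.mulVec_transpose, hQ.eq] at h1
    exact h1
  · simpa [dotProduct_comm] using hf

lemma rank_add_vecMulVec {r : ℕ} (Q : Matrix (Fin r) (Fin r) F) (hQ : Q.IsSymm)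
    (a : Fin r → F) (ha : a ∉ LinearMap.range Q.mulVecLin) (c : F) (hc : c ≠ 0) :
    Q.rank + 1 ≤ (Q + c • Matrix.vecMulVec a a).rank := by
  obtain ⟨v, hv, -, hav⟩ := exists_ker_of_notMem Q hQ _ le_rfl a ha
  have hlt : LinearMap.ker (Q + c • Matrix.vecMulVec a a).mulVecLin < LinearMap.ker Q.mulVecLin := by
    have key : ∀ u, (Q + c • Matrix.vecMulVec a a).mulVec u = Q.mulVec u + (c * (a ⬝ᵥ u)) • a := by
      intro u
      rw [Matrix.add_mulVec, Matrix.smul_mulVec, Matrix.vecMulVec_mulVec]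
      simp [mul_smul]
    refine lt_of_le_of_ne ?_ ?_
    · intro u hu
      simp only [LinearMap.mem_ker, Matrix.mulVecLin_apply] at hu ⊢
      rw [key] at hu
      by_cases h0 : a ⬝ᵥ u = 0
      · simpa [h0] using hu
      · exfalso
        apply ha
        refine ⟨(-(c * (a ⬝ᵥ u))⁻¹) • u, ?_⟩
        have h1 : Q.mulVec u = -((c * (a ⬝ᵥ u)) • a) := eq_neg_of_add_eq_zero_left hu
        rw [Matrix.mulVecLin_apply, Matrix.mulVec_smul, h1, smul_neg, neg_smul, neg_neg, smul_smul,
          inv_mul_cancel₀ (mul_ne_zero hc h0), one_smul]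
    · intro h
      have : v ∈ LinearMap.ker (Q + c • Matrix.vecMulVec a a).mulVecLin := by
        rw [h]; simpa using hv
      simp only [LinearMap.mem_ker, Matrix.mulVecLin_apply] at this
      rw [key, hv, zero_add, smul_eq_zero] at this
      rcases this with h | h
      · exact (mul_ne_zero hc hav) h
      · apply hav; simp [h]
  have h1 := Submodule.finrank_lt_finrank_of_lt hlt
  have h2 := (Q + c • Matrix.vecMulVec a a).mulVecLin.finrank_range_add_finrank_ker
  have h3 := Q.mulVecLin.finrank_range_add_finrank_ker
  unfold Matrix.rank
  omega

lemma rank_add_le' {m n : Type*} [Fintype m] [Fintype n] (A B : Matrix m n F) :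
    (A + B).rank ≤ A.rank + B.rank := by
  unfold Matrix.rank
  rw [Matrix.mulVecLin_add]
  exact (Submodule.finrank_mono (LinearMap.range_add_le _ _)).trans
    (Submodule.finrank_add_le_finrank_add_finrank _ _)

lemma rank_add_vecMulVec_le {r : ℕ} (Q : Matrix (Fin r) (Fin r) F) (a : Fin r → F) (c : F) :
    (Q + c • Matrix.vecMulVec a a).rank ≤ Q.rank + 1 := by
  refine (rank_add_le' _ _).trans ?_
  rw [← Matrix.smul_vecMulVec]
  have := Matrix.rank_vecMulVec_le (c • a) a
  omega

lemma exists_single_notMem {r : ℕ} (V : Submodule F (Fin r → F)) (hV : V ≠ ⊤) :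
    ∃ i, (Pi.single i 1 : Fin r → F) ∉ V := by
  by_contra! h
  apply hV
  rw [eq_top_iff, ← (Pi.basisFun F (Fin r)).span_eq, Submodule.span_le]
  rintro _ ⟨i, rfl⟩
  simpa using h i

end LinAlg


section Determinantal

/-- The locus of ideals containing all submaximal minors. -/
def DD {R : Type*} [CommRing R] {r : ℕ} (Q : Matrix (Fin r) (Fin r) R) (p : Ideal R) : Prop :=
  ∀ f g : Fin (r - 1) ↪ Fin r, (Q.submatrix f g).det ∈ p

lemma DD.mono {R : Type*} [CommRing R] {r : ℕ} {Q : Matrix (Fin r) (Fin r) R} {p q : Ideal R}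
    (h : DD Q p) (hpq : p ≤ q) : DD Q q := fun f g => hpq (h f g)

lemma DD_comap {R S : Type*} [CommRing R] [CommRing S] {r : ℕ} (Q : Matrix (Fin r) (Fin r) R)
    (φ : R →+* S) (p : Ideal S) : DD (Q.map φ) p ↔ DD Q (p.comap φ) := by
  unfold DD
  refine forall_congr' fun f => forall_congr' fun g => ?_
  rw [Ideal.mem_comap, RingHom.map_det, Matrix.submatrix_map, RingHom.mapMatrix_apply]

lemma DD_iff_rank {R F : Type*} [CommRing R] [Field F] {r : ℕ} (Q : Matrix (Fin r) (Fin r) R)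
    (φ : R →+* F) (p : Ideal R) (hp : RingHom.ker φ = p) :
    DD Q p ↔ (Q.map φ).rank + 2 ≤ r := by
  subst hp
  rw [← minors_zero_iff, RingHom.ker_eq_comap_bot, ← DD_comap]
  rfl

lemma adj_block_zero_imp {F : Type*} [Field F] {r : ℕ} (M : Matrix (Fin r) (Fin r) F)
    (U : Matrix (Fin r) (Fin 2) F) (hN : (Matrix.fromBlocks M U Uᵀ 0).det ≠ 0)
    (hS : ∀ a b, (Matrix.fromBlocks M U Uᵀ 0).adjugate (Sum.inr a) (Sum.inr b) = 0) :
    M.rank + 2 ≤ r := by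
  set N := Matrix.fromBlocks M U Uᵀ 0 with hNdef
  have h1 := N.mul_adjugate
  have hS' : N.adjugate.toBlocks₂₂ = 0 := by ext a b; exact hS a b
  rw [← Matrix.fromBlocks_toBlocks N.adjugate, hS', hNdef, Matrix.fromBlocks_multiply,
    ← Matrix.fromBlocks_one, Matrix.fromBlocks_smul, Matrix.fromBlocks_inj] at h1
  obtain ⟨-, h12, -, h22⟩ := h1
  simp only [Matrix.mul_zero, add_zero, smul_zero, ← hNdef] at h12 h22
  have h3 := Matrix.rank_add_rank_le_card_of_mul_eq_zero h12
  have h4 := Matrix.rank_mul_le_right Uᵀ N.adjugate.toBlocks₁₂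
  rw [h22, Matrix.rank_of_det_ne_zero (by simp [hN])] at h4
  simp at h3 h4
  omega

lemma adj_block_zero {F : Type*} [Field F] {r : ℕ} (M : Matrix (Fin r) (Fin r) F)
    (U : Matrix (Fin r) (Fin 2) F) (hN : (Matrix.fromBlocks M U Uᵀ 0).det ≠ 0)
    (hM : M.rank + 2 ≤ r) (a b : Fin 2) :
    (Matrix.fromBlocks M U Uᵀ 0).adjugate (Sum.inr a) (Sum.inr b) = 0 := by
  set N := Matrix.fromBlocks M U Uᵀ 0 with hNdef
  have h1 := N.adjugate_mul
  rw [← Matrix.fromBlocks_toBlocks N.adjugate, hNdef, Matrix.fromBlocks_multiply,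
    ← Matrix.fromBlocks_one, Matrix.fromBlocks_smul, Matrix.fromBlocks_inj] at h1
  obtain ⟨-, -, h21, -⟩ := h1
  simp only [smul_zero, ← hNdef] at h21
  let L : LinearMap.ker M.mulVecLin →ₗ[F] (Fin 2 → F) := Uᵀ.mulVecLin.domRestrict _
  have hinj : Function.Injective L := by
    rw [← LinearMap.ker_eq_bot, LinearMap.ker_eq_bot']
    rintro ⟨v, hv⟩ hL
    have hv0 : M.mulVec v = 0 := by simpa using hv
    have hL0 : Uᵀ.mulVec v = 0 := hL
    have h5 : N.mulVec (Sum.elim v 0) = 0 := by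
      rw [hNdef, Matrix.fromBlocks_mulVec]
      simp [hv0, hL0]
    have h6 : Sum.elim v (0 : Fin 2 → F) = 0 := by
      by_contra hne
      exact hN (Matrix.exists_mulVec_eq_zero_iff.mp ⟨_, hne, h5⟩)
    ext i
    exact congrFun h6 (Sum.inl i)
  have hrk := M.mulVecLin.finrank_range_add_finrank_ker
  have hM' : Module.finrank F (LinearMap.range M.mulVecLin) + 2 ≤ r := hM
  have hle := LinearMap.finrank_le_finrank_of_injective hinj
  simp at hrk hle
  have hsurj : Function.Surjective L :=
    (LinearMap.injective_iff_surjective_of_finrank_eq_finrank (by simp; omega)).mp hinj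
  have hz : N.adjugate.toBlocks₂₂ = 0 := by
    apply Matrix.ext_of_mulVec_single
    intro i
    obtain ⟨⟨v, hv⟩, hL⟩ := hsurj (Pi.single i 1)
    have hv0 : M.mulVec v = 0 := by simpa using hv
    have hL' : Uᵀ.mulVec v = Pi.single i 1 := hL
    have h7 := congrArg (fun A => A.mulVec v) h21
    simp only [Matrix.add_mulVec, ← Matrix.mulVec_mulVec, hv0, hL'] at h7
    ext k
    simpa using congrFun h7 k
  exact congrFun (congrFun hz a) b

lemma exists_border {F : Type*} [Field F] {r : ℕ} (M : Matrix (Fin r) (Fin r) F)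
    (hs : M.IsSymm) (hM : M.rank + 2 = r) : ∃ t : Fin 2 → Fin r,
    (Matrix.fromBlocks M (Matrix.of fun k c => if k = t c then 1 else 0)
      (Matrix.of fun k c => if k = t c then 1 else 0)ᵀ 0 : Matrix _ _ F).det ≠ 0 := by
  have hM' : Module.finrank F (LinearMap.range M.mulVecLin) + 2 = r := hM
  set V1 := LinearMap.range M.mulVecLin with hV1
  obtain ⟨i, hi⟩ := exists_single_notMem V1 (by
    intro h; rw [h, finrank_top] at hM'; simp at hM')
  set V2 := V1 ⊔ Submodule.span F {(Pi.single i 1 : Fin r → F)} with hV2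
  have hV2le : Module.finrank F V2 ≤ Module.finrank F V1 + 1 := by
    refine (Submodule.finrank_add_le_finrank_add_finrank _ _).trans ?_
    gcongr
    exact (finrank_span_le_card _).trans (by simp)
  obtain ⟨j, hj⟩ := exists_single_notMem V2 (by
    intro h; rw [h, finrank_top] at hV2le; simp at hV2le; omega)
  set V3 := V2 ⊔ Submodule.span F {(Pi.single j 1 : Fin r → F)} with hV3
  have h12 : V1 < V2 := by
    refine lt_of_le_of_ne le_sup_left fun h => hi ?_
    rw [h]; exact Submodule.mem_sup_right (Submodule.mem_span_singleton_self _)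
  have h23 : V2 < V3 := by
    refine lt_of_le_of_ne le_sup_left fun h => hj ?_
    rw [h]; exact Submodule.mem_sup_right (Submodule.mem_span_singleton_self _)
  have f12 := Submodule.finrank_lt_finrank_of_lt h12
  have f23 := Submodule.finrank_lt_finrank_of_lt h23
  have htop : V3 = ⊤ := by
    apply Submodule.eq_top_of_finrank_eq
    have := Submodule.finrank_le V3
    simp at this ⊢
    omega
  refine ⟨![i, j], fun hdet => ?_⟩
  obtain ⟨x, hx, hx0⟩ := Matrix.exists_mulVec_eq_zero_iff.mpr hdet
  apply hx
  set v : Fin r → F := x ∘ Sum.inl with hv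
  set c : Fin 2 → F := x ∘ Sum.inr with hc
  have hxe : x = Sum.elim v c := by simp [hv, hc]
  rw [Matrix.fromBlocks_mulVec] at hx0
  have hA : M.mulVec v + (Matrix.of fun k c => if k = ![i, j] c then (1 : F) else 0).mulVec c = 0 := by
    ext k; exact congrFun hx0 (Sum.inl k)
  have hB : ∀ l : Fin 2, v (![i, j] l) = 0 := by
    intro l
    have := congrFun hx0 (Sum.inr l)
    simpa [Matrix.mulVec, dotProduct, ← hv] using this
  have hUc : (Matrix.of fun k c => if k = ![i, j] c then (1 : F) else 0).mulVec c
      = c 0 • Pi.single i 1 + c 1 • Pi.single j 1 := by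
    ext k
    simp [Matrix.mulVec, dotProduct, Fin.sum_univ_two, Pi.single_apply]
    congr
  rw [hUc] at hA
  have hc1 : c 1 = 0 := by
    by_contra h
    apply hj
    have : (Pi.single j 1 : Fin r → F) = (c 1)⁻¹ • (M.mulVec (-v) - c 0 • Pi.single i 1) := by
      have h2 : M.mulVec (-v) - c 0 • Pi.single i 1 = c 1 • Pi.single j 1 := by
        rw [Matrix.mulVec_neg]
        linear_combination (exp := 1) -hA
      rw [h2, smul_smul, inv_mul_cancel₀ h, one_smul]
    rw [this]
    refine V2.smul_mem _ (V2.sub_mem (le_sup_left (a := V1) ⟨_, rfl⟩) (V2.smul_mem _ ?_))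
    exact Submodule.mem_sup_right (Submodule.mem_span_singleton_self _)
  rw [hc1, zero_smul, add_zero] at hA
  have hc0 : c 0 = 0 := by
    by_contra h
    apply hi
    have : (Pi.single i 1 : Fin r → F) = (c 0)⁻¹ • (M.mulVec (-v)) := by
      have h2 : M.mulVec (-v) = c 0 • Pi.single i 1 := by
        rw [Matrix.mulVec_neg]
        linear_combination (exp := 1) -hA
      rw [h2, smul_smul, inv_mul_cancel₀ h, one_smul]
    rw [this]
    exact V1.smul_mem _ ⟨_, rfl⟩
  rw [hc0, zero_smul, add_zero] at hA
  have hle : V3 ≤ LinearMap.ker (dotProductEquiv F (Fin r) v) := by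
    refine sup_le (sup_le ?_ ?_) ?_
    · rintro _ ⟨u, rfl⟩
      simp only [LinearMap.mem_ker, dotProductEquiv_apply_apply, Matrix.mulVecLin_apply]
      rw [Matrix.dotProduct_mulVec, ← Matrix.mulVec_transpose, hs.eq, hA, zero_dotProduct]
    · rw [Submodule.span_singleton_le_iff_mem]
      simpa using hB 0
    · rw [Submodule.span_singleton_le_iff_mem]
      simpa using hB 1
  have hv0 : v = 0 := by
    apply dotProduct_eq_zero
    intro u
    have : u ∈ V3 := by rw [htop]; trivial
    simpa using hle this
  rw [hxe, hv0]
  have : c = 0 := by ext l; fin_cases l <;> simp [hc0, hc1]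
  rw [this]
  ext (k | k) <;> rfl

end Determinantal


section HeightBound

open Polynomial in
lemma comap_map_C' {R : Type*} [CommRing R] (p : Ideal R) :
    (p.map (C : R →+* R[X])).comap C = p := by
  ext a
  rw [Ideal.mem_comap, Ideal.mem_map_C_iff]
  constructor
  · intro h; simpa using h 0
  · intro h n
    rw [coeff_C]
    split_ifs
    · exact h
    · exact p.zero_mem

open Polynomial in
lemma height_le_height_map_C {R : Type*} [CommRing R] (p : Ideal R) [p.IsPrime] :
    p.height ≤ (p.map (C : R →+* R[X])).height := by
  have : (p.map (C : R →+* R[X])).IsPrime := Ideal.isPrime_map_C_of_isPrime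
  let f : PrimeSpectrum R → PrimeSpectrum R[X] :=
    fun q => ⟨q.asIdeal.map C, Ideal.isPrime_map_C_of_isPrime⟩
  have hf : StrictMono f := by
    apply Monotone.strictMono_of_injective
    · intro a b hab
      exact Ideal.map_mono (f := (C : R →+* R[X])) hab
    · intro a b hab
      have h1 : a.asIdeal.map (C : R →+* R[X]) = b.asIdeal.map C := congrArg PrimeSpectrum.asIdeal hab
      have := congrArg (Ideal.comap C) h1
      rw [comap_map_C', comap_map_C'] at this
      exact PrimeSpectrum.ext this
  have := Order.height_le_height_apply_of_strictMono f hf ⟨p, ‹_›⟩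
  rwa [← PrimeSpectrum.height_eq_orderHeight, ← PrimeSpectrum.height_eq_orderHeight] at this

/-- rank exactly `r - 2` at `p`. -/
lemma height_le_three_base {R : Type*} [CommRing R] [IsNoetherianRing R] {r : ℕ}
    (Q : Matrix (Fin r) (Fin r) R) (hQ : Q.IsSymm) (p : Ideal R) [p.IsPrime]
    (hp : DD Q p) (hmin : ∀ q : Ideal R, q.IsPrime → q ≤ p → DD Q q → p ≤ q)
    (hrk : (Q.map (algebraMap R p.ResidueField)).rank + 2 = r) : p.height ≤ 3 := by
  obtain ⟨t, ht⟩ := exists_border (Q.map (algebraMap R p.ResidueField)) (hQ.map _) hrk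
  set U : Matrix (Fin r) (Fin 2) R := Matrix.of fun k c => if k = t c then 1 else 0 with hU
  set N := Matrix.fromBlocks Q U Uᵀ 0 with hN
  have hUmap : ∀ {F : Type _} [Field F] (φ : R →+* F),
      U.map φ = Matrix.of fun k c => if k = t c then 1 else 0 := by
    intro F _ φ
    ext k c
    simp only [hU, Matrix.map_apply, Matrix.of_apply]
    split_ifs <;> simp
  have hNmap : ∀ {F : Type _} [Field F] (φ : R →+* F),
      N.map φ = Matrix.fromBlocks (Q.map φ) (U.map φ) (U.map φ)ᵀ 0 := by
    intro F _ φ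
    rw [hN, Matrix.fromBlocks_map, Matrix.transpose_map]
    simp
  have hNs : N.IsSymm := by
    rw [hN]; exact Matrix.IsSymm.fromBlocks hQ rfl (by simp [Matrix.IsSymm])
  have hadj : N.adjugate (Sum.inr 1) (Sum.inr 0) = N.adjugate (Sum.inr 0) (Sum.inr 1) := by
    have := N.adjugate_transpose
    rw [hNs.eq] at this
    exact congrFun (congrFun this.symm (Sum.inr 1)) (Sum.inr 0) |>.trans rfl
  have hdetp : N.det ∉ p := by
    intro h
    apply ht
    rw [← hUmap (algebraMap R p.ResidueField), ← hNmap, ← RingHom.mapMatrix_apply, ← RingHom.map_det,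
      Ideal.algebraMap_residueField_eq_zero.mpr h]
  set s : Set R := {N.adjugate (Sum.inr 0) (Sum.inr 0), N.adjugate (Sum.inr 0) (Sum.inr 1),
    N.adjugate (Sum.inr 1) (Sum.inr 1)} with hs
  have hmapadj : ∀ {F : Type _} [Field F] (φ : R →+* F) (a b),
      φ (N.adjugate a b) = (Matrix.fromBlocks (Q.map φ) (U.map φ) (U.map φ)ᵀ 0).adjugate a b := by
    intro F _ φ a b
    rw [← hNmap, ← RingHom.mapMatrix_apply, ← RingHom.map_adjugate]
    rfl
  have hmem : p ∈ (Ideal.span s).minimalPrimes := by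
    refine ⟨⟨‹_›, ?_⟩, ?_⟩
    · rw [Ideal.span_le]
      have h1 : ∀ a b : Fin 2, N.adjugate (Sum.inr a) (Sum.inr b) ∈ p := by
        intro a b
        rw [← Ideal.algebraMap_residueField_eq_zero, hmapadj]
        apply adj_block_zero
        · rw [hUmap]; exact ht
        · exact hrk.le
      rintro _ (rfl | rfl | rfl) <;> exact h1 _ _
    · rintro q ⟨hqp, hsq⟩ hqle
      refine hmin q hqp hqle ?_
      rw [DD_iff_rank Q (algebraMap R q.ResidueField) q (Ideal.ker_algebraMap_residueField q)]
      rw [Ideal.span_le] at hsq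
      have h00 := hsq (show N.adjugate (Sum.inr 0) (Sum.inr 0) ∈ s by simp [hs])
      have h01 := hsq (show N.adjugate (Sum.inr 0) (Sum.inr 1) ∈ s by simp [hs])
      have h11 := hsq (show N.adjugate (Sum.inr 1) (Sum.inr 1) ∈ s by simp [hs])
      apply adj_block_zero_imp _ (U.map (algebraMap R q.ResidueField))
      · rw [← hNmap, ← RingHom.mapMatrix_apply, ← RingHom.map_det, Ne,
          Ideal.algebraMap_residueField_eq_zero]
        exact fun h => hdetp (hqle h)
      · intro a b
        rw [← hmapadj, Ideal.algebraMap_residueField_eq_zero]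
        fin_cases a <;> fin_cases b
        · exact h00
        · exact h01
        · exact hadj ▸ h01
        · exact h11
  refine (Ideal.height_le_card_of_mem_minimalPrimes_span (by simp [hs]) hmem).trans ?_
  have : s.ncard ≤ 3 := by
    refine (Set.ncard_insert_le _ _).trans ?_
    have := Set.ncard_insert_le (N.adjugate (Sum.inr 0) (Sum.inr 1))
      {N.adjugate (Sum.inr 1) (Sum.inr 1)}
    rw [Set.ncard_singleton] at this
    omega
  exact_mod_cast this

open Polynomial in
/-- Step: a minimal prime stays minimal after adding a diagonal variable. -/
lemma minimal_step {R : Type*} [CommRing R] [IsNoetherianRing R] {r : ℕ}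
    (Q : Matrix (Fin r) (Fin r) R) (p : Ideal R) [p.IsPrime]
    (hmin : ∀ q : Ideal R, q.IsPrime → q ≤ p → DD Q q → p ≤ q) (A : Matrix (Fin r) (Fin r) R[X])
    (q : Ideal R[X]) (hq : q.IsPrime) (hqp : q ≤ p.map C) (hDD : DD (Q.map C + (X : R[X]) • A) q) :
    p.map C ≤ q := by
  by_contra hnot
  have hlt : q < p.map C := lt_of_le_not_ge hqp hnot
  have hPp : (p.map (C : R →+* R[X])).IsPrime := Ideal.isPrime_map_C_of_isPrime
  set ev : R[X] →+* R := evalRingHom 0 with hev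
  set m : Ideal R[X] := p.comap ev with hm
  have hmp : m.IsPrime := Ideal.comap_isPrime _ _
  have hXm : X ∈ m := by simp [hm, hev]
  have hPm : p.map C ≤ m := by
    rw [Ideal.map_le_iff_le_comap]
    intro a ha
    simpa [hm, hev] using ha
  have hXP : (X : R[X]) ∉ p.map C := by
    intro h
    rw [Ideal.mem_map_C_iff] at h
    have := h 1
    simp at this
    exact ‹p.IsPrime›.one_notMem this
  have hPltm : p.map C < m := lt_of_le_of_ne hPm fun h => hXP (h ▸ hXm)
  have hmin2 : m ∈ (q ⊔ Ideal.span {X}).minimalPrimes := by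
    refine ⟨⟨hmp, sup_le (hqp.trans hPm) (by simpa [Ideal.span_singleton_le_iff_mem] using hXm)⟩, ?_⟩
    rintro P ⟨hP, hle⟩ hPm'
    have hXin : X ∈ P := hle (Ideal.mem_sup_right (Ideal.mem_span_singleton_self _))
    have hqP : q ≤ P := le_sup_left.trans hle
    have hdec : ∀ f : R[X], f - C (ev f) ∈ Ideal.span {(X : R[X])} := by
      intro f
      rw [Ideal.mem_span_singleton, X_dvd_iff]
      simp [hev, coeff_zero_eq_eval_zero]
    have hXle : Ideal.span {(X : R[X])} ≤ P := by simpa [Ideal.span_singleton_le_iff_mem] using hXin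
    have hcp : P.comap C ≤ p := by
      intro a ha
      have : C a ∈ m := hPm' ha
      simpa [hm, hev] using this
    have hev2 : (P.comap C).comap ev = P := by
      ext f
      rw [Ideal.mem_comap, Ideal.mem_comap]
      have := hXle (hdec f)
      constructor
      · intro h; simpa using P.add_mem this h
      · intro h; simpa using P.sub_mem h this
    have hDP : DD Q (P.comap C) := by
      have h1 := hDD.mono hqP
      rw [← hev2, ← DD_comap] at h1
      convert h1
      ext i j
      simp [hev]
    have := hmin _ (Ideal.comap_isPrime C P) hcp hDP
    rw [← hev2]
    exact Ideal.comap_mono this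
  have hht := Ideal.map_height_le_one_of_mem_minimalPrimes hmin2
  -- chain of length two in the quotient
  have hsurj := Ideal.Quotient.mk_surjective (I := q)
  have pr : ∀ J : Ideal R[X], J.IsPrime → q ≤ J → (J.map (Ideal.Quotient.mk q)).IsPrime := by
    intro J hJ hle
    exact Ideal.map_isPrime_of_surjective hsurj (by rwa [Ideal.mk_ker])
  have lt : ∀ J J' : Ideal R[X], q ≤ J → J < J' →
      J.map (Ideal.Quotient.mk q) < J'.map (Ideal.Quotient.mk q) := by
    intro J J' h1 h2
    refine lt_of_le_of_ne (Ideal.map_mono h2.le) fun h => h2.ne ?_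
    have := congrArg (Ideal.comap (Ideal.Quotient.mk q)) h
    rwa [Ideal.comap_map_of_surjective _ hsurj, Ideal.comap_map_of_surjective _ hsurj,
      ← RingHom.ker_eq_comap_bot, Ideal.mk_ker, sup_eq_left.mpr h1,
      sup_eq_left.mpr (h1.trans h2.le)] at this
  have := pr q hq le_rfl
  have := pr _ hPp hqp
  have := pr _ hmp (hqp.trans hPm)
  have a1 := Ideal.height_add_one_le_of_lt_of_isPrime (lt _ _ le_rfl hlt)
  have a2 := Ideal.height_add_one_le_of_lt_of_isPrime (lt _ _ hqp hPltm)
  have a3 : (2 : ℕ∞) ≤ 1 := by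
    refine le_trans ?_ (a2.trans hht)
    calc (2 : ℕ∞) = 0 + 1 + 1 := by norm_num
      _ ≤ _ := by gcongr; exact le_trans (by gcongr; exact zero_le) a1
  exact absurd a3 (by decide)

open Polynomial in
theorem height_le_three_aux (k : ℕ) {r : ℕ} : ∀ {R : Type} [CommRing R] [IsNoetherianRing R]
    (Q : Matrix (Fin r) (Fin r) R) (_ : Q.IsSymm) (p : Ideal R) [p.IsPrime]
    (_ : DD Q p) (_ : ∀ q : Ideal R, q.IsPrime → q ≤ p → DD Q q → p ≤ q)
    (_ : (Q.map (algebraMap R p.ResidueField)).rank + 2 + k = r), p.height ≤ 3 := by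
  induction k with
  | zero => intro R _ _ Q hQ p _ hp hmin hrk; exact height_le_three_base Q hQ p hp hmin hrk
  | succ k ih =>
    intro R _ _ Q hQ p _ hp hmin hrk
    have hPp : (p.map (C : R →+* R[X])).IsPrime := Ideal.isPrime_map_C_of_isPrime
    set P := p.map (C : R →+* R[X]) with hP
    set φ := algebraMap R[X] P.ResidueField with hφ
    have hker : RingHom.ker (φ.comp C) = p := by
      rw [← RingHom.comap_ker, Ideal.ker_algebraMap_residueField]
      exact comap_map_C' p
    set M := Q.map (φ.comp C) with hM
    have hMr : M.rank = (Q.map (algebraMap R p.ResidueField)).rank :=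
      rank_eq_of_ker _ _ (by rw [hker, Ideal.ker_algebraMap_residueField]) _
    have hMs : M.IsSymm := hQ.map _
    obtain ⟨i, hi⟩ := exists_single_notMem (LinearMap.range M.mulVecLin) (by
      intro h
      have : Module.finrank P.ResidueField (LinearMap.range M.mulVecLin) + 2 + (k + 1) = r := by
        have h1 : M.rank + 2 + (k + 1) = r := by rw [hMr]; exact hrk
        exact h1
      rw [h, finrank_top, Module.finrank_fin_fun] at this; omega)
    have hX : φ X ≠ 0 := by
      rw [hφ, Ne, Ideal.algebraMap_residueField_eq_zero, hP, Ideal.mem_map_C_iff]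
      intro h
      have := h 1
      simp at this
      exact ‹p.IsPrime›.one_notMem this
    set A : Matrix (Fin r) (Fin r) R[X] := Matrix.vecMulVec (Pi.single i 1) (Pi.single i 1) with hA
    have hmap : (Q.map C + (X : R[X]) • A).map φ =
        M + φ X • Matrix.vecMulVec (Pi.single i 1) (Pi.single i 1) := by
      ext a b
      simp only [Matrix.map_apply, Matrix.add_apply, map_add, hM, Matrix.smul_apply, smul_eq_mul,
        map_mul, hA, Matrix.vecMulVec_apply, RingHom.comp_apply, Pi.single_apply]
      congr 2
      split_ifs <;> simp
    have hsym : (Q.map C + (X : R[X]) • A).IsSymm := by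
      refine (hQ.map _).add (Matrix.IsSymm.smul ?_ _)
      rw [Matrix.IsSymm, hA, Matrix.transpose_vecMulVec]
    have hr1 := rank_add_vecMulVec M hMs _ hi (φ X) hX
    have hr2 := rank_add_vecMulVec_le M (Pi.single i 1) (φ X)
    have := ih (Q.map C + (X : R[X]) • A) hsym P
      (by
        rw [DD_iff_rank _ φ P (Ideal.ker_algebraMap_residueField P), hmap]; omega)
      (fun q hq hqP hD => minimal_step Q p hmin A q hq hqP hD)
      (by rw [hmap]; omega)
    exact (height_le_height_map_C p).trans this

theorem height_le_three {R : Type} [CommRing R] [IsNoetherianRing R] {r : ℕ}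
    (Q : Matrix (Fin r) (Fin r) R) (hQ : Q.IsSymm) (p : Ideal R) [p.IsPrime]
    (hp : DD Q p) (hmin : ∀ q : Ideal R, q.IsPrime → q ≤ p → DD Q q → p ≤ q) : p.height ≤ 3 := by
  have := (DD_iff_rank Q (algebraMap R p.ResidueField) p (Ideal.ker_algebraMap_residueField p)).mp hp
  exact height_le_three_aux (r - 2 - (Q.map (algebraMap R p.ResidueField)).rank) Q hQ p hp hmin
    (by omega)

end HeightBound

section DetAffine

/-- bordered determinant -/
noncomputable def bd {R : Type*} [CommRing R] {r : ℕ} (A : Matrix (Fin r) (Fin r) R)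
    (u : Fin r → R) : R :=
  (Matrix.fromBlocks A (-Matrix.replicateCol Unit u) (Matrix.replicateRow Unit u) 0).det

lemma det_add_vecMulVec' {R : Type*} [CommRing R] {r : ℕ} (A : Matrix (Fin r) (Fin r) R)
    (u : Fin r → R) (t : R) :
    (A + t • Matrix.vecMulVec u u).det = A.det + t * bd A u := by
  have h1 := Matrix.det_fromBlocks_one₂₂ A (-(t • Matrix.replicateCol Unit u))
    (Matrix.replicateRow Unit u)
  have h2 : A - -(t • Matrix.replicateCol Unit u) * Matrix.replicateRow Unit u
      = A + t • Matrix.vecMulVec u u := by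
    rw [Matrix.neg_mul, sub_neg_eq_add, Matrix.smul_mul, ← Matrix.vecMulVec_eq]
  rw [← h2, ← h1]
  set N := Matrix.fromBlocks A (-Matrix.replicateCol Unit u) (Matrix.replicateRow Unit u) 0 with hN
  have h3 : Matrix.fromBlocks A (-(t • Matrix.replicateCol Unit u)) (Matrix.replicateRow Unit u) 1
      = N.updateCol (Sum.inr ()) (Sum.elim (0 : Fin r → R) (fun _ => 1) +
        t • (Sum.elim (fun i => - u i) (fun _ => 0))) := by
    ext i j
    rcases i with i | i <;> rcases j with j | j <;> simp [hN, Matrix.updateCol_apply]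
  have h4 : N.updateCol (Sum.inr ()) (Sum.elim (0 : Fin r → R) (fun _ => 1)) =
      Matrix.fromBlocks A 0 (Matrix.replicateRow Unit u) 1 := by
    ext i j
    rcases i with i | i <;> rcases j with j | j <;> simp [hN, Matrix.updateCol_apply]
  have h5 : N.updateCol (Sum.inr ()) (Sum.elim (fun i => - u i) (fun _ => 0)) = N := by
    ext i j
    rcases i with i | i <;> rcases j with j | j <;> simp [hN, Matrix.updateCol_apply]
  rw [h3, Matrix.det_updateCol_add, Matrix.det_updateCol_smul, h4, h5,
    Matrix.det_fromBlocks_zero₁₂]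
  simp [bd, hN]

lemma bd_map {R S : Type*} [CommRing R] [CommRing S] {r : ℕ} (A : Matrix (Fin r) (Fin r) R)
    (u : Fin r → R) (φ : R →+* S) : φ (bd A u) = bd (A.map φ) (fun i => φ (u i)) := by
  unfold bd
  rw [RingHom.map_det, RingHom.mapMatrix_apply, Matrix.fromBlocks_map]
  congr 2
  · ext i j; simp
  · ext i j; simp

end DetAffine

section Split
open MvPolynomial

/-- deletion -/
def del {r : ℕ} (w : Fin r → E → K) (e : E) : Fin r → {f : E // f ≠ e} → K := fun i f => w i f

/-- inclusion of polynomial rings -/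
noncomputable def jm (K : Type) [Field K] {E : Type} (e : E) :
    MvPolynomial {f : E // f ≠ e} K →+* MvPolynomial E K :=
  (rename (R := K) (Subtype.val : {f : E // f ≠ e} → E)).toRingHom

lemma jm_C (e : E) (c : K) : jm K e (C c) = C c := by simp [jm]
lemma jm_X (e : E) (f) : jm K e (X f) = X f.1 := by simp [jm]

lemma pderiv_jm (e : E) (f : MvPolynomial {f : E // f ≠ e} K) : pderiv e (jm K e f) = 0 := by
  apply pderiv_eq_zero_of_notMem_vars
  intro h
  have : e ∈ (rename (R := K) (Subtype.val : {f : E // f ≠ e} → E) f).vars := h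
  have := vars_rename _ _ this
  simp at this

lemma Qform_symm {r : ℕ} (w : Fin r → E → K) : (Qform w).IsSymm := by
  ext i j
  simp [Qform, mul_comm]

lemma Qform_split {r : ℕ} (w : Fin r → E → K) (e : E) :
    Qform w = (Qform (del w e)).map (jm K e) +
      (X e : MvPolynomial E K) • Matrix.vecMulVec (fun i => C (w i e)) (fun i => C (w i e)) := by
  refine Matrix.ext fun i j => ?_
  simp only [Qform, Matrix.of_apply, Matrix.add_apply, Matrix.map_apply, Matrix.smul_apply,
    Matrix.vecMulVec_apply, map_sum, map_mul, jm_C, jm_X, smul_eq_mul, del]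
  rw [Fintype.sum_eq_add_sum_subtype_ne _ e, add_comm, mul_comm (X e)]

/-- psi-prime -/
noncomputable def psi' {r : ℕ} (w : Fin r → E → K) (e : E) : MvPolynomial {f : E // f ≠ e} K :=
  bd (Qform (del w e)) (fun i => C (w i e))

lemma psi_split {r : ℕ} (w : Fin r → E → K) (e : E) :
    psi w = jm K e (psi (del w e)) + X e * jm K e (psi' w e) := by
  unfold psi psi'
  rw [bd_map, RingHom.map_det, RingHom.mapMatrix_apply]
  simp only [jm_C]
  rw [← det_add_vecMulVec', ← Qform_split]

lemma pderiv_psi {r : ℕ} (w : Fin r → E → K) (e : E) :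
    pderiv e (psi w) = jm K e (psi' w e) := by
  rw [psi_split w e, map_add, pderiv_jm, Derivation.leibniz, pderiv_jm, pderiv_X_self]
  simp

lemma Qform_split_map {r : ℕ} (w : Fin r → E → K) (e : E) {F : Type*} [CommRing F]
    (φ : MvPolynomial E K →+* F) :
    (Qform w).map φ = (Qform (del w e)).map (φ.comp (jm K e)) +
      φ (X e) • Matrix.vecMulVec (fun i => φ (C (w i e))) (fun i => φ (C (w i e))) := by
  rw [Qform_split w e]
  refine Matrix.ext fun i j => ?_
  simp [Matrix.vecMulVec_apply]

lemma det_add_pderiv {r : ℕ} (w : Fin r → E → K) (e : E) {F : Type*} [CommRing F]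
    (φ : MvPolynomial E K →+* F) :
    ((Qform w).map φ + (1 : F) • Matrix.vecMulVec (fun i => φ (C (w i e)))
      (fun i => φ (C (w i e)))).det =
    φ (psi w) + φ (pderiv e (psi w)) := by
  rw [Qform_split_map w e, add_assoc, ← add_smul, det_add_vecMulVec', pderiv_psi, psi_split w e,
    psi', psi, RingHom.map_det, map_add, map_mul, bd_map, bd_map, RingHom.map_det,
    RingHom.mapMatrix_apply, RingHom.mapMatrix_apply]
  simp only [jm_C]
  simp only [Matrix.map_map, RingHom.coe_comp]
  ring

/-- columns span -/
def Spanning {r : ℕ} (w : Fin r → E → K) : Prop :=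
  Submodule.span K (Set.range (fun e i => w i e)) = ⊤

lemma det_zero_of_rank {F : Type*} [Field F] {r : ℕ} (M : Matrix (Fin r) (Fin r) F)
    (h : M.rank + 1 ≤ r) : M.det = 0 := by
  by_contra h0
  have := Matrix.rank_of_isUnit M ((Matrix.isUnit_iff_isUnit_det M).2 (isUnit_iff_ne_zero.2 h0))
  simp at this
  omega

lemma rank_of_det_zero {F : Type*} [Field F] {r : ℕ} (M : Matrix (Fin r) (Fin r) F)
    (h : M.det = 0) : M.rank + 1 ≤ r := by
  by_contra h0
  obtain ⟨v, hv, hv0⟩ := Matrix.exists_mulVec_eq_zero_iff.2 h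
  have h1 := LinearMap.finrank_range_add_finrank_ker M.mulVecLin
  have h2 : 0 < Module.finrank F (LinearMap.ker M.mulVecLin) := by
    rw [Module.finrank_pos_iff_exists_ne_zero]
    exact ⟨⟨v, by simpa using hv0⟩, by simpa using hv⟩
  have h3 : M.rank + Module.finrank F (LinearMap.ker M.mulVecLin) = r := by
    rw [Module.finrank_fin_fun] at h1; exact h1
  omega

/-- base change of spanning -/
lemma Spanning.exists_notMem {r : ℕ} {w : Fin r → E → K} (hw : Spanning w) {F : Type*} [Field F]
    (ι : K →+* F) (V : Submodule F (Fin r → F)) (hV : V ≠ ⊤) :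
    ∃ e, (fun i => ι (w i e)) ∉ V := by
  by_contra! h
  obtain ⟨i, hi⟩ := exists_single_notMem V hV
  apply hi
  have key : ∀ x ∈ Submodule.span K (Set.range (fun e i => w i e)), (fun i => ι (x i)) ∈ V := by
    intro x hx
    induction hx using Submodule.span_induction with
    | mem x hx => obtain ⟨e, rfl⟩ := hx; exact h e
    | zero =>
      have : (fun i : Fin r => ι ((0 : Fin r → K) i)) = 0 := by ext i; simp
      rw [this]; exact V.zero_mem
    | add x y _ _ hx hy => simpa [Pi.add_def] using V.add_mem hx hy
    | smul c x _ hx => simpa [Pi.smul_def] using V.smul_mem (ι c) hx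
  rw [hw] at key
  have := key (Pi.single i 1) trivial
  convert this using 1
  ext k
  by_cases hk : k = i
  · subst hk; simp
  · simp [hk]

lemma jac_le_iff {r : ℕ} {w : Fin r → E → K} (hw : Spanning w) (p : Ideal (MvPolynomial E K))
    [p.IsPrime] : jacIdeal w ≤ p ↔ DD (Qform w) p := by
  set φ := algebraMap (MvPolynomial E K) p.ResidueField with hφ
  have hker : RingHom.ker φ = p := Ideal.ker_algebraMap_residueField p
  rw [DD_iff_rank _ φ p hker]
  have hmem : ∀ x, x ∈ p ↔ φ x = 0 := fun x => by
    conv_lhs => rw [← hker]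
    rw [RingHom.mem_ker]
  have hpsi : φ (psi w) = ((Qform w).map φ).det := by
    rw [psi, RingHom.map_det, RingHom.mapMatrix_apply]
  have hs : ((Qform w).map φ).IsSymm := (Qform_symm w).map _
  constructor
  · intro h
    have h1 : φ (psi w) = 0 := (hmem _).1 (h (Ideal.subset_span (Or.inl rfl)))
    have h2 : ∀ e, φ (pderiv e (psi w)) = 0 := fun e =>
      (hmem _).1 (h (Ideal.subset_span (Or.inr ⟨e, rfl⟩)))
    have h3 := rank_of_det_zero _ (hpsi ▸ h1)
    obtain ⟨e, he⟩ := hw.exists_notMem (φ.comp C) (LinearMap.range ((Qform w).map φ).mulVecLin) (by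
      intro h
      have h4 : Module.finrank _ (LinearMap.range ((Qform w).map φ).mulVecLin) + 1 ≤ r := h3
      rw [h, finrank_top, Module.finrank_fin_fun] at h4
      omega)
    have h5 := rank_add_vecMulVec _ hs _ he 1 one_ne_zero
    have h6 := det_add_pderiv w e φ
    rw [h1, h2, add_zero] at h6
    have h7 := rank_of_det_zero _ h6
    simp only [RingHom.comp_apply] at h5
    omega
  · intro h
    have h1 : φ (psi w) = 0 := by rw [hpsi]; exact det_zero_of_rank _ (by omega)
    refine Ideal.span_le.2 ?_
    rintro x (hx | ⟨e, rfl⟩)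
    · rw [Set.mem_singleton_iff] at hx
      subst hx
      exact (hmem _).2 h1
    · refine (hmem _).2 ?_
      have h6 := det_add_pderiv w e φ
      rw [h1, zero_add] at h6
      rw [← h6]
      apply det_zero_of_rank
      have := rank_add_vecMulVec_le ((Qform w).map φ) (fun i => φ (C (w i e))) 1
      omega

lemma minor_le_iff {r : ℕ} (w : Fin r → E → K) (p : Ideal (MvPolynomial E K)) :
    minorIdeal w ≤ p ↔ DD (Qform w) p := by
  unfold minorIdeal
  rw [Ideal.span_le]
  constructor
  · intro h f g
    exact h ⟨f, g, rfl⟩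
  · rintro h _ ⟨f, g, rfl⟩
    exact h f g

end Split

section Iso
open MvPolynomial

/-- splitting off one variable -/
noncomputable def splitIso (K : Type) [Field K] {E : Type} [DecidableEq E] (e : E) :
    MvPolynomial E K ≃+* Polynomial (MvPolynomial {f : E // f ≠ e} K) :=
  ((renameEquiv K (Equiv.optionSubtypeNe e).symm).trans
    (optionEquivLeft K {f : E // f ≠ e})).toRingEquiv

lemma splitIso_X (e : E) : splitIso K e (X e) = Polynomial.X := by
  simp [splitIso]

lemma splitIso_jm (e : E) (f : MvPolynomial {f : E // f ≠ e} K) :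
    splitIso K e (jm K e f) = Polynomial.C f := by
  induction f using MvPolynomial.induction_on with
  | C a => rw [jm_C]; simp [splitIso]
  | add p q hp hq => rw [map_add, map_add, hp, hq, map_add]
  | mul_X p f hp =>
    rw [map_mul, map_mul, hp, map_mul, jm_X]
    congr 1
    simp [splitIso, f.2]

lemma map_jm (e : E) (q : Ideal (MvPolynomial {f : E // f ≠ e} K)) :
    q.map (jm K e) = (q.map (Polynomial.C)).comap (splitIso K e) := by
  have h : (Polynomial.C : MvPolynomial {f : E // f ≠ e} K →+* _) =
      ((splitIso K e : MvPolynomial E K →+* _)).comp (jm K e) := by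
    refine RingHom.ext fun f => ?_
    rw [RingHom.comp_apply]
    exact (splitIso_jm e f).symm
  rw [h, ← Ideal.map_map]
  exact (Ideal.comap_map_of_bijective (splitIso K e) (splitIso K e).bijective).symm

lemma map_jm_prime (e : E) (q : Ideal (MvPolynomial {f : E // f ≠ e} K)) [q.IsPrime] :
    (q.map (jm K e)).IsPrime := by
  rw [map_jm]
  have := Ideal.isPrime_map_C_of_isPrime (P := q)
  infer_instance

lemma X_notMem_map_jm (e : E) (q : Ideal (MvPolynomial {f : E // f ≠ e} K)) [hq : q.IsPrime] :
    X e ∉ q.map (jm K e) := by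
  rw [map_jm, Ideal.mem_comap, splitIso_X, Ideal.mem_map_C_iff]
  intro h
  have := h 1
  simp at this
  exact hq.one_notMem this

lemma height_le_map_jm (e : E) (q : Ideal (MvPolynomial {f : E // f ≠ e} K)) [hq : q.IsPrime] :
    q.height ≤ (q.map (jm K e)).height := by
  rw [map_jm, RingEquiv.height_comap]
  exact height_le_height_map_C q

lemma comap_map_jm (e : E) (q : Ideal (MvPolynomial {f : E // f ≠ e} K)) :
    (q.map (jm K e)).comap (jm K e) = q := by
  ext f
  rw [Ideal.mem_comap, map_jm, Ideal.mem_comap, splitIso_jm, ← Ideal.mem_comap, comap_map_C']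

lemma height_add_one (e : E) (p : Ideal (MvPolynomial E K)) [hp : p.IsPrime]
    (h : (p.comap (jm K e)).map (jm K e) ≠ p) : (p.comap (jm K e)).height + 1 ≤ p.height := by
  have := map_jm_prime e (p.comap (jm K e))
  have h1 := height_le_map_jm e (p.comap (jm K e))
  have hlt : (p.comap (jm K e)).map (jm K e) < p := lt_of_le_of_ne Ideal.map_comap_le h
  have h2 := Ideal.height_add_one_le_of_lt_of_isPrime hlt
  exact (add_le_add_left h1 1).trans h2

end Iso

section Conn
variable {V : Type} [AddCommGroup V] [Module K V] [FiniteDimensional K V]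
variable {Vq : Type} [AddCommGroup Vq] [Module K Vq] [FiniteDimensional K Vq]

/-- rank of a set of columns -/
noncomputable def crk (K : Type) [Field K] {V : Type} [AddCommGroup V] [Module K V] {E : Type}
    (a : E → V) (S : Set E) : ℕ :=
  Module.finrank K (Submodule.span K (Set.image a S))

/-- connectedness of a vector configuration -/
def Conn (K : Type) [Field K] {V : Type} [AddCommGroup V] [Module K V] {E : Type}
    (a : E → V) : Prop :=
  Submodule.span K (Set.range a) = ⊤ ∧ ∀ S : Set E, S.Nonempty → Sᶜ.Nonempty →
    Module.finrank K V + 1 ≤ crk K a S + crk K a Sᶜ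

lemma crk_submod (a : E → V) (S T : Set E) :
    crk K a (S ∪ T) + crk K a (S ∩ T) ≤ crk K a S + crk K a T := by
  unfold crk
  rw [← Submodule.finrank_sup_add_finrank_inf_eq (Submodule.span K (a '' S)),
    ← Submodule.span_union, ← Set.image_union]
  refine Nat.add_le_add_left (Submodule.finrank_mono ?_) _
  · refine le_inf ?_ ?_ <;> apply Submodule.span_mono <;> apply Set.image_mono
    · exact Set.inter_subset_left
    · exact Set.inter_subset_right

lemma crk_singleton_le (a : E → V) (e : E) : crk K a {e} ≤ 1 := by
  unfold crk
  rw [Set.image_singleton]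
  simpa using finrank_span_le_card (R := K) ({a e} : Set V)

lemma crk_mono (a : E → V) {S T : Set E} (h : S ⊆ T) : crk K a S ≤ crk K a T := by
  unfold crk
  exact Submodule.finrank_mono (Submodule.span_mono (Set.image_mono h))

lemma crk_insert_le (a : E → V) (S : Set E) (e : E) : crk K a (insert e S) ≤ crk K a S + 1 := by
  have h := crk_submod (K := K) a S {e}
  have := crk_singleton_le (K := K) a e
  rw [Set.union_singleton] at h
  omega

lemma crk_le (a : E → V) (S : Set E) : crk K a S ≤ Module.finrank K V := Submodule.finrank_le _

lemma Conn.compl_span {a : E → V} (h : Conn K a) {e : E} (hne : ({e}ᶜ : Set E).Nonempty) :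
    Submodule.span K (a '' {e}ᶜ) = ⊤ ∧ a e ≠ 0 := by
  have h1 := h.2 {e} (Set.singleton_nonempty e) hne
  have h2 := crk_singleton_le (K := K) a e
  constructor
  · apply Submodule.eq_top_of_finrank_eq
    have := crk_le (K := K) a {e}ᶜ
    change crk K a {e}ᶜ = _
    omega
  · intro h0
    have h3 : crk K a {e} = 0 := by
      unfold crk
      rw [Set.image_singleton, h0]
      simp
    have := crk_le (K := K) a {e}ᶜ
    omega

lemma uncross {a : E → V} (h : Conn K a) (e : E) (S T S' T' : Set E)
    (h1 : S ∪ T = {e}ᶜ) (h2 : Disjoint S T) (h3 : S' ∪ T' = {e}ᶜ) (h4 : Disjoint S' T')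
    (h5 : crk K a S + crk K a T ≤ Module.finrank K V)
    (h6 : crk K a (insert e S') + crk K a (insert e T') ≤ Module.finrank K V + 1) :
    S ∩ S' = ∅ ∨ T ∩ T' = ∅ := by
  by_contra! hc
  obtain ⟨hc1, hc2⟩ := hc
  have e1 := crk_submod (K := K) a S (insert e S')
  have e2 := crk_submod (K := K) a T (insert e T')
  have m1 : ∀ x, x ∈ S ∨ x ∈ T ↔ x ≠ e := fun x => by
    have := Set.ext_iff.1 h1 x; simpa using this
  have m3 : ∀ x, x ∈ S' ∨ x ∈ T' ↔ x ≠ e := fun x => by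
    have := Set.ext_iff.1 h3 x; simpa using this
  have m2 : ∀ x, x ∈ S → x ∉ T := fun x hx => Set.disjoint_left.1 h2 hx
  have m4 : ∀ x, x ∈ S' → x ∉ T' := fun x hx => Set.disjoint_left.1 h4 hx
  have i1 : S ∩ insert e S' = S ∩ S' := by
    ext x; simp only [Set.mem_inter_iff, Set.mem_insert_iff]; have := m1 x; tauto
  have i2 : T ∩ insert e T' = T ∩ T' := by
    ext x; simp only [Set.mem_inter_iff, Set.mem_insert_iff]; have := m1 x; tauto
  have i3 : (S ∩ S')ᶜ = T ∪ insert e T' := by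
    ext x; simp only [Set.mem_inter_iff, Set.mem_insert_iff, Set.mem_compl_iff, Set.mem_union]
    have := m1 x; have := m2 x; have := m3 x; have := m4 x; tauto
  have i4 : (T ∩ T')ᶜ = S ∪ insert e S' := by
    ext x; simp only [Set.mem_inter_iff, Set.mem_insert_iff, Set.mem_compl_iff, Set.mem_union]
    have := m1 x; have := m2 x; have := m3 x; have := m4 x; tauto
  have c1 := h.2 (S ∩ S') hc1 (by rw [i3]; exact ⟨e, by simp⟩)
  have c2 := h.2 (T ∩ T') hc2 (by rw [i4]; exact ⟨e, by simp⟩)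
  rw [i3] at c1
  rw [i4] at c2
  rw [i1] at e1
  rw [i2] at e2
  omega

lemma finrank_le_map_add_one (π : V →ₗ[K] Vq) (v : V) (hπ : LinearMap.ker π = Submodule.span K {v})
    (U : Submodule K V) : Module.finrank K U ≤ Module.finrank K (U.map π) + 1 := by
  have h1 := LinearMap.finrank_range_add_finrank_ker (π.domRestrict U)
  have h2 : LinearMap.range (π.domRestrict U) = U.map π := LinearMap.range_domRestrict _ _
  have h3 : Module.finrank K (LinearMap.ker (π.domRestrict U)) ≤ 1 := by
    have h4 : Module.finrank K (LinearMap.ker π) ≤ 1 := by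
      rw [hπ]; simpa using finrank_span_le_card (R := K) ({v} : Set V)
    refine le_trans ?_ h4
    rw [LinearMap.ker_domRestrict]
    refine LinearMap.finrank_le_finrank_of_injective
      (f := (U.subtype.comp (Submodule.subtype _)).codRestrict (LinearMap.ker π) ?_) ?_
    · rintro ⟨x, hx⟩; simpa using hx
    · intro x y hxy
      have := congrArg Subtype.val hxy
      simpa using this
  rw [h2] at h1
  omega

lemma tutte {a : E → V} (h : Conn K a) (e : E) (hne : ({e}ᶜ : Set E).Nonempty)
    (π : V →ₗ[K] Vq) (hs : Function.Surjective π) (hπ : LinearMap.ker π = Submodule.span K {a e}) :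
    Conn K (fun f : {f : E // f ≠ e} => a f) ∨ Conn K (fun f : {f : E // f ≠ e} => π (a f)) := by
  obtain ⟨hsp, ha⟩ := h.compl_span hne
  have hval : ∀ S : Set {f : E // f ≠ e}, Subtype.val '' S ∪ Subtype.val '' Sᶜ = ({e}ᶜ : Set E) := by
    intro S
    rw [← Set.image_union, Set.union_compl_self, Set.image_univ, Subtype.range_coe_subtype]
    rfl
  have hdis : ∀ S : Set {f : E // f ≠ e},
      Disjoint (Subtype.val '' S : Set E) (Subtype.val '' Sᶜ) := fun S =>
    (Set.disjoint_image_iff Subtype.val_injective).2 disjoint_compl_right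
  have hrk : Module.finrank K V = Module.finrank K Vq + 1 := by
    have h1 := LinearMap.finrank_range_add_finrank_ker π
    rw [LinearMap.range_eq_top.2 hs, finrank_top, hπ, finrank_span_singleton ha] at h1
    exact h1.symm
  have hval' : ∀ {U : Type} [AddCommGroup U] [Module K U] (g : E → U) (S : Set {f : E // f ≠ e}),
      crk K (fun f : {f : E // f ≠ e} => g f) S = crk K g (Subtype.val '' S) := by
    intro U _ _ g S
    unfold crk
    rw [Set.image_image]
  by_contra! hc
  obtain ⟨hc1, hc2⟩ := hc
  have hr : Set.range (fun f : {f : E // f ≠ e} => a f) = a '' {e}ᶜ := by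
    ext x; simp
  have hr' : Set.range (fun f : {f : E // f ≠ e} => π (a f)) = π '' (a '' {e}ᶜ) := by
    ext x; simp
  unfold Conn at hc1 hc2
  rw [hr, hsp] at hc1
  rw [hr', Submodule.span_image, hsp, Submodule.map_top, LinearMap.range_eq_top.2 hs] at hc2
  push Not at hc1 hc2
  obtain ⟨S, hS, hSc, hS2⟩ := hc1 rfl
  obtain ⟨S', hS', hSc', hS2'⟩ := hc2 rfl
  rw [hval', hval'] at hS2
  rw [hval' (fun f => π (a f)), hval' (fun f => π (a f))] at hS2'
  have hins : ∀ T : Set E, crk K a (insert e T) ≤ crk K (fun f => π (a f)) T + 1 := by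
    intro T
    have h1 := finrank_le_map_add_one π (a e) hπ (Submodule.span K (a '' (insert e T)))
    have h2 : (Submodule.span K (a '' (insert e T))).map π =
        Submodule.span K ((fun f => π (a f)) '' T) := by
      have h0 : π (a e) = 0 := by
        rw [← LinearMap.mem_ker, hπ]; exact Submodule.mem_span_singleton_self _
      rw [← Submodule.span_image, Set.image_image, Set.image_insert_eq, h0,
        Submodule.span_insert_zero]
    rw [h2] at h1
    exact h1
  have i1 := hins (Subtype.val '' S')
  have i2 := hins (Subtype.val '' S'ᶜ)
  have u1 := uncross h e _ _ _ _ (hval S) (hdis S) (hval S') (hdis S') (by omega) (by omega)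
  have u2 := uncross h e _ _ _ _ (hval S) (hdis S) (by rw [Set.union_comm]; exact hval S')
    (hdis S').symm (by omega) (by omega)
  simp only [← Set.image_inter Subtype.val_injective, Set.image_eq_empty] at u1 u2
  have n1 : ∀ A B : Set {f : E // f ≠ e}, A.Nonempty → A ∩ B = ∅ → A ∩ Bᶜ = ∅ → False := by
    rintro A B ⟨x, hx⟩ h1 h2
    by_cases hB : x ∈ B
    · exact Set.notMem_empty x (h1 ▸ ⟨hx, hB⟩)
    · exact Set.notMem_empty x (h2 ▸ ⟨hx, hB⟩)
  rcases u1 with u1 | u1 <;> rcases u2 with u2 | u2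
  · exact n1 S S' hS u1 u2
  · exact n1 S' S hS' (by rw [Set.inter_comm]; exact u1) (by rw [Set.inter_comm]; exact u2)
  · exact n1 S'ᶜ S hSc' (by rw [Set.inter_comm]; exact u2) (by rw [Set.inter_comm]; exact u1)
  · exact n1 Sᶜ S' hSc u2 u1

end Conn

section Irred
open MvPolynomial

/-- columns -/
def cols {r : ℕ} (w : Fin r → E → K) : E → (Fin r → K) := fun e i => w i e

lemma exists_spec {r : ℕ} (w : Fin r → E → K) (hs : Spanning w) (A : Set E) :
    ∃ c : E → Polynomial K, (∀ f, (c f).natDegree ≤ 1) ∧ (∀ f, f ∉ A → ∃ k, c f = Polynomial.C k) ∧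
      aeval c (psi w) ≠ 0 ∧ (aeval c (psi w)).natDegree = crk K (cols w) A := by
  classical
  obtain ⟨S, hSA, -, hS, hSi⟩ := exists_linearIndepOn_extension
    (linearIndepOn_empty K (cols w)) (Set.empty_subset A)
  obtain ⟨B, -, hSB, hB, hBi⟩ := exists_linearIndepOn_extension hSi (Set.subset_univ S)
  have hBtop : Submodule.span K (cols w '' B) = ⊤ := by
    rw [eq_top_iff, ← hs, Submodule.span_le]
    rw [Set.image_univ] at hB
    exact hB
  have hBcard : Fintype.card B = r := by
    have h1 := finrank_span_eq_card (R := K) (b := fun x : B => cols w x) hBi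
    rw [← Set.image_eq_range, hBtop, finrank_top, Module.finrank_fin_fun] at h1
    exact h1.symm
  have hScard : Fintype.card S = crk K (cols w) A := by
    have h1 := finrank_span_eq_card (R := K) (b := fun x : S => cols w x) hSi
    rw [← Set.image_eq_range] at h1
    rw [← h1, crk]
    have h2 : Submodule.span K (cols w '' S) = Submodule.span K (cols w '' A) :=
      le_antisymm (Submodule.span_mono (Set.image_mono hSA)) (Submodule.span_le.2 hS)
    rw [h2]
  let η : Fin r ≃ B := (Fintype.equivFinOfCardEq hBcard).symm
  let β : Fin r → E := fun k => (η k).1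
  have hβ : Function.Injective β := Subtype.val_injective.comp η.injective
  have hβr : Set.range β = B := by
    ext x
    constructor
    · rintro ⟨k, rfl⟩; exact (η k).2
    · intro hx; exact ⟨η.symm ⟨x, hx⟩, by simp [β]⟩
  let c : E → Polynomial K := fun f => if f ∈ S then Polynomial.X else if f ∈ B then 1 else 0
  have hc1 : ∀ f, f ∈ S → c f = Polynomial.X := fun f hf => by simp [c, hf]
  have hc2 : ∀ f, f ∉ S → f ∈ B → c f = 1 := fun f hf hf' => by simp [c, hf, hf']
  have hc3 : ∀ f, f ∉ B → c f = 0 := fun f hf => by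
    have : f ∉ S := fun h => hf (hSB h)
    simp [c, hf, this]
  let N : Matrix (Fin r) (Fin r) K := Matrix.of fun i k => w i (β k)
  have hN : N.det ≠ 0 := by
    have h1 : LinearIndependent K N.col := by
      have : LinearIndependent K ((fun x : B => cols w x) ∘ η) :=
        LinearIndependent.comp hBi η η.injective
      exact this
    have := Matrix.linearIndependent_cols_iff_isUnit.1 h1
    rw [Matrix.isUnit_iff_isUnit_det] at this
    exact this.ne_zero
  have hval : aeval c (psi w) = Polynomial.C (N.det ^ 2) * Polynomial.X ^ (crk K (cols w) A) := by
    have h1 : aeval c (psi w) = ((Qform w).map (aeval c : MvPolynomial E K →ₐ[K] _)).det := by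
      rw [psi, AlgHom.map_det, AlgHom.mapMatrix_apply]
    have h2 : (Qform w).map (aeval c : MvPolynomial E K →ₐ[K] _) =
        N.map Polynomial.C * Matrix.diagonal (c ∘ β) * (N.map Polynomial.C)ᵀ := by
      refine Matrix.ext fun i j => ?_
      rw [Matrix.mul_apply]
      simp only [Matrix.mul_diagonal, Matrix.transpose_apply, Matrix.map_apply, Qform,
        Matrix.of_apply, map_sum, map_mul, aeval_X, Function.comp]
      symm
      refine Fintype.sum_of_injective β hβ _ _ ?_ ?_
      · intro f hf
        rw [hβr] at hf
        rw [hc3 f hf, mul_zero]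
      · intro k
        simp [N]
        ring
    have h3 : (N.map Polynomial.C).det = Polynomial.C N.det := by
      rw [RingHom.map_det, RingHom.mapMatrix_apply]
    have h4 : ∏ k, (c ∘ β) k = Polynomial.X ^ (crk K (cols w) A) := by
      have h5 : ∀ k, (c ∘ β) k = if β k ∈ S then (Polynomial.X : Polynomial K) else 1 := by
        intro k
        by_cases hk : β k ∈ S
        · rw [if_pos hk]; exact hc1 _ hk
        · rw [if_neg hk]; exact hc2 _ hk (η k).2
      rw [Finset.prod_congr rfl fun k _ => h5 k, Finset.prod_ite]
      rw [Finset.prod_const_one, mul_one, Finset.prod_const]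
      congr 1
      rw [← hScard, ← Set.toFinset_card, ← Finset.card_image_of_injective _ hβ]
      congr 1
      ext x
      simp only [Finset.mem_image, Finset.mem_filter, Finset.mem_univ, true_and, Set.mem_toFinset]
      constructor
      · rintro ⟨k, hk, rfl⟩; exact hk
      · intro hx
        have : x ∈ Set.range β := by rw [hβr]; exact hSB hx
        obtain ⟨k, rfl⟩ := this
        exact ⟨k, hx, rfl⟩
    rw [h1, h2, Matrix.det_mul, Matrix.det_mul, Matrix.det_transpose, h3, Matrix.det_diagonal, h4,
      map_pow]
    ring
  refine ⟨c, ?_, ?_, ?_, ?_⟩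
  · intro f
    simp only [c]
    split_ifs <;> simp
  · intro f hf
    have hfS : f ∉ S := fun h => hf (hSA h)
    by_cases hfB : f ∈ B
    · exact ⟨1, by rw [hc2 f hfS hfB, map_one]⟩
    · exact ⟨0, by rw [hc3 f hfB, map_zero]⟩
  · rw [hval]
    exact mul_ne_zero (by simpa using hN) (pow_ne_zero _ Polynomial.X_ne_zero)
  · rw [hval, Polynomial.natDegree_C_mul_X_pow _ _ (pow_ne_zero _ hN)]

lemma psi_ne_zero {r : ℕ} (w : Fin r → E → K) (hs : Spanning w) : psi w ≠ 0 := by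
  obtain ⟨c, -, -, h, -⟩ := exists_spec w hs ∅
  rintro h0
  rw [h0, map_zero] at h
  exact h rfl

lemma crk_le_totalDegree {r : ℕ} (w : Fin r → E → K) (hs : Spanning w) (A : Set E)
    (g h : MvPolynomial E K) (hgh : psi w = g * h) (hg : ∀ f ∈ g.vars, f ∉ A) :
    crk K (cols w) A ≤ h.totalDegree := by
  obtain ⟨c, hc1, hc2, hne, hdeg⟩ := exists_spec w hs A
  rw [hgh, map_mul] at hne hdeg
  have hg0 := left_ne_zero_of_mul hne
  have hh0 := right_ne_zero_of_mul hne
  rw [Polynomial.natDegree_mul hg0 hh0] at hdeg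
  have h1 : (aeval c g).natDegree = 0 := by
    have : ∃ c' : E → K, ∀ f, f ∉ A → c f = Polynomial.C (c' f) := by
      choose! c' hc' using hc2
      exact ⟨c', hc'⟩
    obtain ⟨c', hc'⟩ := this
    have h2 : aeval c g = aeval (algebraMap K (Polynomial K) ∘ c') g :=
      eval₂Hom_congr' rfl (fun i hi _ => hc' i (hg i hi)) rfl
    rw [h2, aeval_algebraMap_apply]
    exact Polynomial.natDegree_C _
  have h2 := aeval_natDegree_le h le_rfl c hc1
  omega

lemma totalDegree_psi_le {r : ℕ} (w : Fin r → E → K) : (psi w).totalDegree ≤ r := by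
  unfold psi
  rw [Matrix.det_apply]
  refine totalDegree_finsetSum_le fun σ _ => ?_
  have h1 : (∏ i, Qform w (σ i) i).totalDegree ≤ r := by
    refine (totalDegree_finsetProd _ _).trans ?_
    calc _ ≤ ∑ i : Fin r, 1 := Finset.sum_le_sum fun i _ => ?_
      _ = r := by simp
    simp only [Qform, Matrix.of_apply]
    refine totalDegree_finsetSum_le fun f _ => ?_
    refine (totalDegree_mul _ _).trans ?_
    rw [totalDegree_C, totalDegree_X]
  rcases Int.units_eq_one_or (Equiv.Perm.sign σ) with h | h
  · rw [h, one_smul]; exact h1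
  · rw [h, Units.neg_smul, one_smul, totalDegree_neg]; exact h1

lemma degreeOf_jm (e : E) (f : MvPolynomial {f : E // f ≠ e} K) : degreeOf e (jm K e f) = 0 := by
  by_contra h0
  rw [← Ne, ← mem_vars_iff_degreeOf_ne_zero] at h0
  have : e ∈ (rename (R := K) (Subtype.val : {f : E // f ≠ e} → E) f).vars := h0
  have := vars_rename _ _ this
  simp at this

lemma degreeOf_psi_le {r : ℕ} (w : Fin r → E → K) (e : E) : degreeOf e (psi w) ≤ 1 := by
  rw [psi_split w e]
  refine (degreeOf_add_le _ _ _).trans (max_le ?_ ((degreeOf_mul_le _ _ _).trans ?_))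
  · rw [degreeOf_jm]; omega
  · rw [degreeOf_jm, degreeOf_X, if_pos rfl]

lemma irred {r : ℕ} (w : Fin r → E → K) (hw : Conn K (cols w)) (g h : MvPolynomial E K)
    (hgh : psi w = g * h) (hu : ¬ IsUnit h) (e : E) (he : degreeOf e h = 0) : False := by
  have hs : Spanning w := hw.1
  have hne := psi_ne_zero w hs
  have hg0 : g ≠ 0 := by rintro rfl; rw [zero_mul] at hgh; exact hne hgh
  have hh0 : h ≠ 0 := by rintro rfl; rw [mul_zero] at hgh; exact hne hgh
  have hv : h.vars.Nonempty := by
    rw [Finset.nonempty_iff_ne_empty]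
    intro h0
    rw [vars_eq_empty_iff_eq_C] at h0
    apply hu
    rw [h0]
    refine IsUnit.map _ (isUnit_iff_ne_zero.2 ?_)
    intro h1
    rw [h1, map_zero] at h0
    exact hh0 h0
  have h1 := hw.2 (h.vars : Set E) hv ⟨e, by
    simp only [Set.mem_compl_iff, Finset.mem_coe, mem_vars_iff_degreeOf_ne_zero]
    simpa using he⟩
  have h2 := crk_le_totalDegree w hs (h.vars : Set E) g h hgh (by
    intro f hf hf'
    rw [Finset.mem_coe] at hf'
    rw [mem_vars_iff_degreeOf_ne_zero] at hf hf'
    have := degreeOf_psi_le w f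
    rw [hgh, degreeOf_mul_eq hg0 hh0] at this
    omega)
  have h3 := crk_le_totalDegree w hs (h.vars : Set E)ᶜ h g (by rw [hgh, mul_comm]) (by
    intro f hf
    simpa using hf)
  have h4 := totalDegree_psi_le w
  rw [hgh, totalDegree_mul_of_isDomain hg0 hh0] at h4
  rw [Module.finrank_fin_fun] at h1
  omega

end Irred

section Lower
open MvPolynomial

lemma exists_contraction {r : ℕ} (a : Fin r → K) (ha : a ≠ 0) :
    ∃ (s : ℕ) (P : Matrix (Fin s) (Fin r) K), s + 1 = r ∧ Function.Surjective P.mulVecLin ∧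
      LinearMap.ker P.mulVecLin = Submodule.span K {a} := by
  have h1 := Submodule.finrank_quotient_add_finrank (Submodule.span K {a})
  rw [finrank_span_singleton ha, Module.finrank_fin_fun] at h1
  set s := Module.finrank K ((Fin r → K) ⧸ Submodule.span K {a}) with hs
  let η : ((Fin r → K) ⧸ Submodule.span K {a}) ≃ₗ[K] (Fin s → K) :=
    LinearEquiv.ofFinrankEq _ _ (by rw [Module.finrank_fin_fun])
  let π : (Fin r → K) →ₗ[K] (Fin s → K) := η.toLinearMap.comp (Submodule.mkQ _)
  have hπ : (LinearMap.toMatrix' π).mulVecLin = π := by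
    rw [← Matrix.toLin'_apply', Matrix.toLin'_toMatrix']
  refine ⟨s, LinearMap.toMatrix' π, h1, ?_, ?_⟩
  · rw [hπ]
    exact η.surjective.comp (Submodule.mkQ_surjective _)
  · rw [hπ]
    simp only [π]
    rw [LinearEquiv.ker_comp, Submodule.ker_mkQ]

lemma rank_mul_lt {F : Type*} [Field F] {r s : ℕ} (P : Matrix (Fin s) (Fin r) F)
    (Q : Matrix (Fin r) (Fin r) F) (a : Fin r → F) (ha : a ≠ 0) (hPa : P.mulVec a = 0)
    (haQ : a ∈ LinearMap.range Q.mulVecLin) : (P * Q).rank + 1 ≤ Q.rank := by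
  obtain ⟨v, hv⟩ := haQ
  have hv : Q.mulVec v = a := hv
  have hlt : LinearMap.ker Q.mulVecLin < LinearMap.ker (P * Q).mulVecLin := by
    refine lt_of_le_of_ne ?_ ?_
    · intro x hx
      rw [LinearMap.mem_ker, Matrix.mulVecLin_apply] at hx ⊢
      rw [← Matrix.mulVec_mulVec, hx, Matrix.mulVec_zero]
    · intro h
      have : v ∈ LinearMap.ker Q.mulVecLin := by
        rw [h, LinearMap.mem_ker, Matrix.mulVecLin_apply, ← Matrix.mulVec_mulVec, hv, hPa]
      rw [LinearMap.mem_ker, Matrix.mulVecLin_apply, hv] at this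
      exact ha this
  have h1 := Submodule.finrank_lt_finrank_of_lt hlt
  have h2 := LinearMap.finrank_range_add_finrank_ker Q.mulVecLin
  have h3 := LinearMap.finrank_range_add_finrank_ker (P * Q).mulVecLin
  unfold Matrix.rank
  omega

/-- the coefficient matrix with polynomial entries -/
noncomputable def Wm {r : ℕ} (w : Matrix (Fin r) E K) : Matrix (Fin r) E (MvPolynomial E K) :=
  w.map (C : K →+* MvPolynomial E K)

/-- the diagonal matrix of variables -/
noncomputable def Dm (K : Type) [Field K] (E : Type) [DecidableEq E] :
    Matrix E E (MvPolynomial E K) := Matrix.diagonal X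

lemma Qform_eq {r : ℕ} (w : Fin r → E → K) :
    Qform w = Wm (Matrix.of w) * Dm K E * (Wm (Matrix.of w))ᵀ := by
  refine Matrix.ext fun i j => ?_
  rw [Matrix.mul_apply]
  simp only [Matrix.mul_diagonal, Matrix.transpose_apply, Matrix.map_apply, Qform, Wm, Dm,
        Matrix.of_apply, map_mul]
  exact Finset.sum_congr rfl fun f _ => by ring

lemma Qform_contr {r s : ℕ} (w : Fin r → E → K) (P : Matrix (Fin s) (Fin r) K) :
    Qform (fun i f => P.mulVec (cols w f) i) =
      P.map (C : K →+* MvPolynomial E K) * Qform w * (P.map (C : K →+* MvPolynomial E K))ᵀ := by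
  have h : Matrix.of (fun i f => P.mulVec (cols w f) i) = P * Matrix.of w := by
    ext i f; rfl
  have h2 : Wm (P * Matrix.of w) = P.map (C : K →+* MvPolynomial E K) * Wm (Matrix.of w) :=
    Matrix.map_mul
  rw [Qform_eq, Qform_eq, h, h2, Matrix.transpose_mul]
  simp only [Matrix.mul_assoc]

/-- setting a variable to zero -/
noncomputable def rho (K : Type) [Field K] {E : Type} [DecidableEq E] (e : E) :
    MvPolynomial E K →+* MvPolynomial {f : E // f ≠ e} K :=
  (aeval (fun f : E => if h : f = e then 0 else X ⟨f, h⟩) :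
    MvPolynomial E K →ₐ[K] MvPolynomial {f : E // f ≠ e} K).toRingHom

lemma rho_X (e : E) : rho K e (X e) = 0 := by simp [rho]

lemma rho_jm (e : E) : (rho K e).comp (jm K e) = RingHom.id _ := by
  refine MvPolynomial.ringHom_ext (fun c => ?_) (fun f => ?_)
  · rw [RingHom.comp_apply, jm_C]
    simp [rho, algebraMap_eq]
  · rw [RingHom.comp_apply, jm_X]
    simp [rho, f.2]

lemma DD_del_of_eq {r : ℕ} (w : Fin r → E → K) (e : E) (p : Ideal (MvPolynomial E K))
    (hp : DD (Qform w) p) (h : (p.comap (jm K e)).map (jm K e) = p) :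
    DD (Qform (del w e)) (p.comap (jm K e)) := by
  have h1 : (Qform w).map (rho K e) = Qform (del w e) := by
    rw [Qform_split_map w e, rho_X, zero_smul, add_zero, rho_jm]
    ext1 i j; rfl
  rw [← h1, DD_comap]
  refine hp.mono ?_
  conv_lhs => rw [← h]
  rw [Ideal.map_le_iff_le_comap, Ideal.comap_comap, rho_jm, Ideal.comap_id]

lemma DD_del_of_X_mem {r : ℕ} (w : Fin r → E → K) (e : E) (p : Ideal (MvPolynomial E K))
    [p.IsPrime] (hp : DD (Qform w) p) (h : X e ∈ p) :
    DD (Qform (del w e)) (p.comap (jm K e)) := by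
  have hker : RingHom.ker (algebraMap (MvPolynomial E K) p.ResidueField) = p :=
    Ideal.ker_algebraMap_residueField p
  rw [DD_iff_rank _ _ p hker, Qform_split_map w e,
    (Ideal.algebraMap_residueField_eq_zero).2 h, zero_smul, add_zero] at hp
  rw [DD_iff_rank _ ((algebraMap (MvPolynomial E K) p.ResidueField).comp (jm K e))]
  · exact hp
  · rw [← RingHom.comap_ker, hker]

lemma DD_contr {r s : ℕ} (w : Fin r → E → K) (e : E) (p : Ideal (MvPolynomial E K))
    [hpp : p.IsPrime] (hp : DD (Qform w) p) (h : (p.comap (jm K e)).map (jm K e) = p)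
    (P : Matrix (Fin s) (Fin r) K) (hs : s + 1 = r) (ha : cols w e ≠ 0)
    (hP : P.mulVec (cols w e) = 0) :
    DD (Qform (fun i (f : {f : E // f ≠ e}) => P.mulVec (cols w f) i)) (p.comap (jm K e)) := by
  have hd := DD_del_of_eq w e p hp h
  have hker : RingHom.ker (algebraMap (MvPolynomial E K) p.ResidueField) = p :=
    Ideal.ker_algebraMap_residueField p
  set φ := algebraMap (MvPolynomial E K) p.ResidueField with hφ
  have hker' : RingHom.ker (φ.comp (jm K e)) = p.comap (jm K e) := by
    rw [← RingHom.comap_ker, hker]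
  have hX : φ (X e) ≠ 0 := by
    rw [Ne, hφ, Ideal.algebraMap_residueField_eq_zero]
    have := X_notMem_map_jm e (p.comap (jm K e))
    rwa [h] at this
  rw [DD_iff_rank _ φ p hker, Qform_split_map w e] at hp
  rw [DD_iff_rank _ _ _ hker'] at hd ⊢
  have hQ : Qform (fun i (f : {f : E // f ≠ e}) => P.mulVec (cols w f) i) =
    P.map (C : K →+* MvPolynomial {f : E // f ≠ e} K) * Qform (del w e) * (P.map (C : K →+* MvPolynomial {f : E // f ≠ e} K))ᵀ := Qform_contr (del w e) P
  rw [hQ]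
  set Q0 := (Qform (del w e)).map (φ.comp (jm K e)) with hQ0
  have hQ0s : Q0.IsSymm := (Qform_symm _).map _
  set P' := P.map (φ.comp C) with hP'
  have hmap : (P.map (C : K →+* MvPolynomial {f : E // f ≠ e} K) * Qform (del w e) * (P.map (C : K →+* MvPolynomial {f : E // f ≠ e} K))ᵀ).map (φ.comp (jm K e)) = P' * Q0 * P'ᵀ := by
    rw [Matrix.map_mul, Matrix.map_mul, Matrix.transpose_map, Matrix.map_map]
    have : ((φ.comp (jm K e)) ∘ C : K → p.ResidueField) = φ.comp C := by
      ext c; simp [jm_C]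
    rw [this]
  rw [hmap]
  have h1 : (P' * Q0 * P'ᵀ).rank ≤ (P' * Q0).rank := Matrix.rank_mul_le_left _ _
  have h2 : (P' * Q0).rank ≤ Q0.rank := Matrix.rank_mul_le_right _ _
  by_cases haQ : (fun i => φ (C (w i e))) ∈ LinearMap.range Q0.mulVecLin
  · have h3 := rank_mul_lt P' Q0 _ (by
      intro h0
      apply ha
      ext i
      have := congrFun h0 i
      simp only [Pi.zero_apply] at this
      exact (φ.comp C).injective (by rw [Pi.zero_apply, map_zero]; exact this)) (by
      have := RingHom.map_mulVec (φ.comp C) P (cols w e)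
      ext i
      have h4 := this i
      rw [hP] at h4
      simp only [Pi.zero_apply, map_zero] at h4
      exact h4.symm) haQ
    omega
  · have h3 := rank_add_vecMulVec Q0 hQ0s _ haQ _ hX
    omega

lemma height_q {r : ℕ} (w : Fin r → E → K) (hw : Conn K (cols w)) (e : E)
    (p : Ideal (MvPolynomial E K)) [hpp : p.IsPrime] (hp : DD (Qform w) p) :
    2 ≤ (p.comap (jm K e)).height := by
  have hs : Spanning w := hw.1
  set q := p.comap (jm K e) with hq
  rw [← jac_le_iff hs] at hp
  have h1 : psi w ∈ p := hp (Ideal.subset_span (Or.inl rfl))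
  have h2 : psi' w e ∈ q := by
    rw [hq, Ideal.mem_comap, ← pderiv_psi]
    exact hp (Ideal.subset_span (Or.inr ⟨e, rfl⟩))
  have h3 : psi (del w e) ∈ q := by
    rw [hq, Ideal.mem_comap]
    have h4 := psi_split w e
    have : jm K e (psi (del w e)) = psi w - X e * jm K e (psi' w e) := by rw [h4]; ring
    rw [this]
    exact p.sub_mem h1 (p.mul_mem_left _ h2)
  have hq0 : q ≠ ⊥ := by
    intro h
    rw [h, Ideal.mem_bot] at h2 h3
    apply psi_ne_zero w hs
    rw [psi_split w e, h2, h3]; simp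
  have hh0 : q.height ≠ 0 := by
    intro h
    rw [Ideal.height_eq_zero_iff] at h
    rw [IsDomain.minimalPrimes_eq_singleton_bot] at h
    exact hq0 h
  have hh1 : q.height ≠ 1 := by
    intro h
    obtain ⟨x, hx, hxp⟩ := Ideal.IsPrime.exists_mem_prime_of_ne_bot (I := q) inferInstance hq0
    have hqx := Ideal.eq_span_singleton_of_height_eq_one h hx hxp
    rw [hqx, Ideal.mem_span_singleton] at h2 h3
    have hd : jm K e x ∣ psi w := by
      rw [psi_split w e]
      exact dvd_add (map_dvd _ h3) (Dvd.dvd.mul_left (map_dvd _ h2) _)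
    obtain ⟨g, hg⟩ := hd
    refine irred w hw g (jm K e x) (by rw [hg, mul_comm]) ?_ e (degreeOf_jm e x)
    intro hu
    exact hpp.ne_top (Ideal.eq_top_of_isUnit_mem _ (show jm K e x ∈ p from hx) hu)
  have h5 : 1 ≤ q.height := Order.one_le_iff_pos.2 (pos_iff_ne_zero.2 hh0)
  have h6 : 1 < q.height := lt_of_le_of_ne h5 (Ne.symm hh1)
  exact Order.add_one_le_of_lt h6

lemma lower_aux (n : ℕ) : ∀ {E : Type} [Fintype E] [DecidableEq E] (_ : Fintype.card E = n)
    {r : ℕ} (w : Fin r → E → K) (_ : Conn K (cols w)) (p : Ideal (MvPolynomial E K))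
    [p.IsPrime] (_ : DD (Qform w) p), 3 ≤ p.height := by
  induction n using Nat.strong_induction_on with
  | _ n ih =>
  intro E _ _ hn r w hw p hpp hp
  have hr : 2 ≤ r := by
    have := (DD_iff_rank _ _ p (Ideal.ker_algebraMap_residueField p)).1 hp
    omega
  have hE : Nonempty E := by
    by_contra h
    rw [not_nonempty_iff] at h
    have h1 := hw.1
    rw [Set.range_eq_empty, Submodule.span_empty] at h1
    have h2 := congrArg (fun U : Submodule K (Fin r → K) => Module.finrank K U) h1
    simp at h2
    omega
  obtain ⟨e⟩ := hE
  have hne : ({e}ᶜ : Set E).Nonempty := by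
    by_contra h
    rw [Set.not_nonempty_iff_eq_empty, Set.compl_empty_iff] at h
    have h1 := hw.1
    rw [← Set.image_univ, ← h] at h1
    have h2 := crk_singleton_le (K := K) (cols w) e
    rw [crk, h1, finrank_top, Module.finrank_fin_fun] at h2
    omega
  have hq2 := height_q w hw e p hp
  by_cases hpq : (p.comap (jm K e)).map (jm K e) = p
  · have hle : (p.comap (jm K e)).height ≤ p.height := by
      have := height_le_map_jm e (p.comap (jm K e))
      rwa [hpq] at this
    refine le_trans ?_ hle
    have hcard : Fintype.card {f : E // f ≠ e} < n := by
      rw [← hn]; exact Fintype.card_subtype_lt (x := e) (by simp)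
    obtain ⟨-, ha⟩ := hw.compl_span hne
    obtain ⟨s, P, hs, hPs, hPk⟩ := exists_contraction _ ha
    rcases tutte hw e hne P.mulVecLin hPs hPk with h | h
    · exact ih _ hcard rfl (del w e) h _ (DD_del_of_eq w e p hp hpq)
    · refine ih _ hcard rfl (fun i (f : {f : E // f ≠ e}) => P.mulVec (cols w f) i) h _
        (DD_contr w e p hp hpq P hs ha ?_)
      rw [← Matrix.mulVecLin_apply, ← LinearMap.mem_ker, hPk]
      exact Submodule.mem_span_singleton_self _
  · refine le_trans ?_ (height_add_one e p hpq)
    exact add_le_add_left hq2 1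

end Lower

section Final
open MvPolynomial

lemma rkOn_eq {r : ℕ} (W : Submodule K (E → K)) (w : Fin r → E → K) (hw : IsBasisOf w W)
    (S : Finset E) : rkOn W S = crk K (cols w) (S : Set E) := by
  let A : Matrix (Fin r) {x : E // x ∈ S} K := Matrix.of fun i f => w i f
  have h1 : W.map (LinearMap.funLeft K K (fun e : {x : E // x ∈ S} => (e : E))) =
      Submodule.span K (Set.range A.row) := by
    rw [← hw.2, Submodule.map_span, ← Set.range_comp]
    rfl
  have h2 : cols w '' (S : Set E) = Set.range A.col := by
    rw [Set.image_eq_range]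
    rfl
  unfold rkOn crk
  rw [h1, h2, ← Matrix.rank_eq_finrank_span_row, ← Matrix.rank_eq_finrank_span_cols]

lemma rkOn_univ {r : ℕ} (W : Submodule K (E → K)) (w : Fin r → E → K) (hw : IsBasisOf w W) :
    crk K (cols w) Set.univ = r := by
  have h1 : cols w '' Set.univ = Set.range (Matrix.of w).col := by
    rw [Set.image_univ]; rfl
  rw [crk, h1, ← Matrix.rank_eq_finrank_span_cols, Matrix.rank_eq_finrank_span_row]
  have := finrank_span_eq_card hw.1
  rw [Fintype.card_fin] at this
  exact this

lemma spanning_of_basis {r : ℕ} (W : Submodule K (E → K)) (w : Fin r → E → K)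
    (hw : IsBasisOf w W) : Spanning w := by
  apply Submodule.eq_top_of_finrank_eq
  rw [Module.finrank_fin_fun]
  have := rkOn_univ W w hw
  rw [crk, Set.image_univ] at this
  exact this

lemma three_sep {r : ℕ} (W : Submodule K (E → K)) (w : Fin r → E → K) (hw : IsBasisOf w W)
    (h3 : ThreeConnected W) (T : Set E) :
    (1 ≤ T.ncard → 1 ≤ Tᶜ.ncard → r + 1 ≤ crk K (cols w) T + crk K (cols w) Tᶜ) ∧
    (2 ≤ T.ncard → 2 ≤ Tᶜ.ncard → r + 2 ≤ crk K (cols w) T + crk K (cols w) Tᶜ) := by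
  classical
  have h := h3 T.toFinset
  have hc : T.toFinset.card = T.ncard := (Set.ncard_eq_toFinset_card' T).symm
  have hc' : T.toFinsetᶜ.card = Tᶜ.ncard := by
    rw [Set.ncard_eq_toFinset_card', Set.toFinset_compl]
  unfold KSep at h
  rw [rkOn_eq W w hw, rkOn_eq W w hw, rkOn_eq W w hw, hc, hc', Finset.coe_univ,
    rkOn_univ W w hw, Finset.coe_compl, Set.coe_toFinset] at h
  constructor
  · intro a b
    by_contra hcon
    exact h.1 ⟨by omega, a, b⟩
  · intro a b
    by_contra hcon
    exact h.2 ⟨by omega, a, b⟩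

lemma conn_del {r : ℕ} (W : Submodule K (E → K)) (w : Fin r → E → K) (hw : IsBasisOf w W)
    (h3 : ThreeConnected W) (hcard : 3 < Fintype.card E) (e : E) :
    Conn K (cols (del w e)) := by
  classical
  have hce : ({e}ᶜ : Set E).ncard + 1 = Fintype.card E := by
    have := Set.ncard_add_ncard_compl ({e} : Set E)
    rw [Set.ncard_singleton, Nat.card_eq_fintype_card] at this
    omega
  have hcrk : ∀ S : Set {f : E // f ≠ e},
      crk K (cols (del w e)) S = crk K (cols w) (Subtype.val '' S) := by
    intro S
    unfold crk
    rw [Set.image_image]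
    rfl
  constructor
  · apply Submodule.eq_top_of_finrank_eq
    rw [Module.finrank_fin_fun]
    have h1 := (three_sep W w hw h3 {e}).1 (by simp) (by omega)
    have h2 := crk_singleton_le (K := K) (cols w) e
    have h3 := crk_le (K := K) (cols w) {e}ᶜ
    rw [Module.finrank_fin_fun] at h3
    have h4 := hcrk Set.univ
    rw [Set.image_univ, Subtype.range_coe_subtype] at h4
    have h5 : {x : E | x ≠ e} = {e}ᶜ := rfl
    rw [h5, crk, Set.image_univ] at h4
    rw [h4]
    omega
  · have key : ∀ S : Set {f : E // f ≠ e}, S.Nonempty → 2 ≤ Sᶜ.ncard →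
        r + 1 ≤ crk K (cols (del w e)) S + crk K (cols (del w e)) Sᶜ := by
      intro S hS hS2
      rw [hcrk, hcrk]
      have hcompl : (Subtype.val '' Sᶜ : Set E)ᶜ = insert e (Subtype.val '' S) := by
        ext x
        by_cases hx : x = e <;> simp [hx]
      have h1 := (three_sep W w hw h3 (Subtype.val '' Sᶜ)).2
        (by rw [Set.ncard_image_of_injective _ Subtype.val_injective]; exact hS2)
        (by
          rw [hcompl, Set.ncard_insert_of_notMem (by simp),
            Set.ncard_image_of_injective _ Subtype.val_injective]
          have := (Set.ncard_pos (s := S)).2 hS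
          omega)
      rw [hcompl] at h1
      have := crk_insert_le (K := K) (cols w) (Subtype.val '' S) e
      omega
    intro S hS hSc
    rw [Module.finrank_fin_fun]
    have h1 := Set.ncard_add_ncard_compl S
    have h2 : Nat.card {f : E // f ≠ e} = ({e}ᶜ : Set E).ncard := rfl
    by_cases h : 2 ≤ Sᶜ.ncard
    · exact key S hS h
    · have := key Sᶜ hSc (by rw [compl_compl]; omega)
      rw [compl_compl] at this
      omega

lemma final_aux {r : ℕ} (W : Submodule K (E → K)) (w : Fin r → E → K) (hw : IsBasisOf w W)
    (h3 : ThreeConnected W) (hcard : 3 < Fintype.card E) (p : Ideal (MvPolynomial E K))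
    [p.IsPrime] (hp : DD (Qform w) p)
    (hmin : ∀ q : Ideal (MvPolynomial E K), q.IsPrime → q ≤ p → DD (Qform w) q → p ≤ q) (e : E) :
    X e ∉ p := by
  intro hX
  have h1 := height_le_three _ (Qform_symm w) p hp hmin
  have h2 := lower_aux _ rfl (del w e) (conn_del W w hw h3 hcard e) _ (DD_del_of_X_mem w e p hp hX)
  have h4 := height_add_one e p (by
    intro h
    have := X_notMem_map_jm e (p.comap (jm K e))
    rw [h] at this
    exact this hX)
  have h5 : (3 : ℕ∞) + 1 ≤ 3 := ((add_le_add_left h2 1).trans h4).trans h1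
  exact absurd h5 (by decide)

end Final

/-- **Theorem (Generic points for 3-connected matroids).**
Let `W ⊆ K^E` realize a `3`-connected matroid with `|E| > 3`.  Then no minimal prime
over the Jacobian ideal `J_W` (equivalently, over the submaximal-minor ideal `M_W`)
contains a coordinate `x_e`: all generic points of `Σ_W` and `Δ_W` lie in the torus. -/
theorem minimal_primes_avoid_coordinates_of_threeConnected
    (W : Submodule K (E → K)) {r : ℕ} (w : Fin r → E → K)
    (hw : IsBasisOf w W) (h3 : ThreeConnected W) (hcard : 3 < Fintype.card E) :
    (∀ p ∈ (jacIdeal w).minimalPrimes, ∀ e : E, MvPolynomial.X e ∉ p) ∧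
    (∀ p ∈ (minorIdeal w).minimalPrimes, ∀ e : E, MvPolynomial.X e ∉ p) := by
  have hs := spanning_of_basis W w hw
  constructor
  · rintro p ⟨⟨hp, hle⟩, hmin⟩ e
    refine final_aux W w hw h3 hcard p ((jac_le_iff hs p).1 hle) ?_ e
    intro q hq hqp hqd
    exact hmin ⟨hq, (jac_le_iff hs q).2 hqd⟩ hqp
  · rintro p ⟨⟨hp, hle⟩, hmin⟩ e
    refine final_aux W w hw h3 hcard p ((minor_le_iff w p).1 hle) ?_ e
    intro q hq hqp hqd
    exact hmin ⟨hq, (minor_le_iff w q).2 hqd⟩ hqp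

end Config
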